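/- arXiv:math/0611599 — 3 statements merged into one kernel-verified Lean document; each statement's English description precedes it below -/
import Mathlib

section
/- For any μ > 1 and any irrational ω ∈ ℝ/ℤ, the Hausdorff dimension of the set A_{μ,ω} = { t ∈ ℝ/ℤ : ‖t + pω‖ < p^{−μ} for infinitely many p ∈ ℕ } equals 1/μ. -/
open scoped ENNReal NNReal Topology
open MeasureTheory Filter

local notation "𝕋" => AddCircle (1:ℝ)

lemma aux_good (ω : 𝕋) (hω : ∀ n : ℕ, 0 < n → n • ω ≠ 0) (N : ℕ) :
    ∃ q : ℕ, N < q ∧ ∀ m : ℕ, 0 < m → m < q → 1 / (2 * (q:ℝ)) ≤ ‖m • ω‖ := by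
  obtain ⟨m0, hm0, hmin⟩ := Finset.exists_min_image (Finset.Icc 1 (N+1)) (fun m : ℕ => ‖m • ω‖)
    ⟨1, by simp⟩
  have hm0' := Finset.mem_Icc.1 hm0
  have hδ : 0 < ‖m0 • ω‖ := norm_pos_iff.2 (hω m0 hm0'.1)
  have hex : ∃ q : ℕ, 0 < q ∧ ‖q • ω‖ < ‖m0 • ω‖ := by
    obtain ⟨n, hn⟩ := exists_nat_one_div_lt hδ
    obtain ⟨j, hj, hj'⟩ := AddCircle.exists_norm_nsmul_le ω (n := n + 1) (by omega)
    refine ⟨j, hj.1, lt_of_le_of_lt hj' (lt_of_le_of_lt ?_ hn)⟩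
    push_cast
    apply one_div_le_one_div_of_le <;> linarith [(Nat.cast_nonneg n : (0:ℝ) ≤ n)]
  classical
  set q := Nat.find hex with hq
  obtain ⟨hq0, hq1⟩ := Nat.find_spec hex
  have hlt : ∀ m : ℕ, 0 < m → m < q → ‖m0 • ω‖ ≤ ‖m • ω‖ := by
    intro m hm hmq
    by_contra h
    exact Nat.find_min hex hmq ⟨hm, not_le.1 h⟩
  have hNq : N + 1 < q := by
    by_contra h
    have := hmin q (Finset.mem_Icc.2 ⟨hq0, not_lt.1 h⟩)
    exact absurd hq1 (not_lt.2 this)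
  refine ⟨q, by omega, fun m hm hmq => le_trans ?_ (hlt m hm hmq)⟩
  obtain ⟨x, rfl⟩ := QuotientAddGroup.mk_surjective ω
  have hn : ∀ n : ℕ, ‖n • (QuotientAddGroup.mk x : 𝕋)‖ = |n * x - round (n * x)| := by
    intro n
    have := UnitAddCircle.norm_eq (x := n * x)
    rw [← this, ← nsmul_eq_mul]; rfl
  have hq1' : ‖q • (QuotientAddGroup.mk x : 𝕋)‖ < ‖m0 • (QuotientAddGroup.mk x : 𝕋)‖ := hq1
  clear_value q
  rw [hn] at hδ hq1' ⊢
  rw [hn] at hq1'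
  set a := round ((m0:ℝ) * x)
  set b := round ((q:ℝ) * x)
  have hqpos : (0:ℝ) < q := by exact_mod_cast (by omega : 0 < q)
  have hmpos : (0:ℝ) < m0 := by exact_mod_cast hm0'.1
  have hmq : (m0:ℝ) < q := by exact_mod_cast (by omega : m0 < q)
  by_contra hcon
  rw [not_le, lt_div_iff₀ (by positivity)] at hcon
  have key : |((m0 * b - q * a : ℤ) : ℝ)| < 1 := by
    have e : ((m0 * b - q * a : ℤ) : ℝ) = q * (m0 * x - a) - m0 * (q * x - b) := by
      push_cast; ring
    rw [e]
    refine lt_of_le_of_lt (abs_sub _ _) ?_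
    rw [abs_mul, abs_mul, abs_of_pos hqpos, abs_of_pos hmpos]
    have := abs_nonneg ((q:ℝ) * x - b)
    nlinarith
  have k0 : m0 * b - q * a = 0 := by
    rw [← Int.abs_lt_one_iff]; exact_mod_cast key
  have k1 : (m0:ℝ) * b - q * a = 0 := by exact_mod_cast k0
  have e : (q:ℝ) * (m0 * x - a) = m0 * (q * x - b) := by linarith
  have e2 := congrArg abs e
  rw [abs_mul, abs_mul, abs_of_pos hqpos, abs_of_pos hmpos] at e2
  have := abs_nonneg ((q:ℝ) * x - b)
  nlinarith

lemma aux_count (ω : 𝕋) (q : ℕ) (hq0 : 0 < q)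
    (hq : ∀ m : ℕ, 0 < m → m < q → 1 / (2 * (q:ℝ)) ≤ ‖m • ω‖) (c : 𝕋) (ρ : ℝ)
    (hρ : 1 / (q:ℝ) ≤ ρ) :
    (((Finset.Ioc q (2*q)).filter (fun p : ℕ => ‖c + p • ω‖ ≤ 3 * ρ)).card : ℝ) ≤ 25 * ρ * q := by
  set S := (Finset.Ioc q (2*q)).filter (fun p : ℕ => ‖c + p • ω‖ ≤ 3 * ρ) with hS
  have hqpos : (0:ℝ) < q := by exact_mod_cast hq0
  have hq1 : (1:ℝ) ≤ q := by exact_mod_cast hq0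
  have hi : (0:ℝ) < 1 / q := by positivity
  have hi1 : 1 / (q:ℝ) ≤ 1 := by rw [div_le_one hqpos]; exact hq1
  have h2 : 1 / (2 * (q:ℝ)) = (1/q) / 2 := by field_simp
  have hdis : (S : Set ℕ).PairwiseDisjoint
      (fun p : ℕ => Metric.closedBall (-(p • ω)) ((1/(q:ℝ))/8)) := by
    have main : ∀ p ∈ S, ∀ p' ∈ S, p < p' →
      Disjoint (Metric.closedBall (-(p • ω)) ((1/(q:ℝ))/8)) (Metric.closedBall (-(p' • ω)) ((1/(q:ℝ))/8)) := by
      intro p hp p' hp' hlt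
      simp only [hS, Finset.mem_filter, Finset.mem_Ioc] at hp hp'
      apply Metric.closedBall_disjoint_closedBall
      have := hq (p' - p) (by omega) (by omega)
      rw [dist_eq_norm]
      have e : -(p • ω) - -(p' • ω) = (p' - p) • ω := by
        rw [sub_nsmul _ hlt.le]; abel
      rw [e]
      linarith
    intro p hp p' hp' hne
    rcases lt_or_gt_of_ne hne with h | h
    · exact main p hp p' hp' h
    · exact (main p' hp' p hp h).symm
  have hsub : (⋃ p ∈ S, Metric.closedBall (-(p • ω)) ((1/(q:ℝ))/8)) ⊆
      Metric.closedBall c (3 * ρ + (1/q)/8) := by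
    intro y hy
    simp only [Set.mem_iUnion] at hy
    obtain ⟨p, hp, hy⟩ := hy
    simp only [hS, Finset.mem_filter] at hp
    rw [Metric.mem_closedBall] at hy ⊢
    have := dist_triangle y (-(p • ω)) c
    have e : dist (-(p • ω)) c = ‖c + p • ω‖ := by
      rw [dist_eq_norm, ← norm_neg]; congr 1; abel
    linarith [hp.2]
  have hv := measure_mono (μ := (volume : Measure 𝕋)) hsub
  rw [measure_biUnion_finset hdis (fun p _ => Metric.isClosed_closedBall.measurableSet)] at hv
  simp only [AddCircle.volume_closedBall, Finset.sum_const, nsmul_eq_mul] at hv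
  rw [min_eq_right (by linarith), ← ENNReal.ofReal_natCast, ← ENNReal.ofReal_mul (by positivity)] at hv
  have hv2 := hv.trans (ENNReal.ofReal_le_ofReal (min_le_right _ _))
  rw [ENNReal.ofReal_le_ofReal_iff (by linarith)] at hv2
  have e : (S.card : ℝ) = (S.card * (2 * (1/(q:ℝ)/8))) * (4 * q) := by field_simp; ring
  rw [e]
  have h3 : (2 * (3 * ρ + 1 / (q:ℝ) / 8)) * (4 * q) = 24 * ρ * q + 1 := by field_simp; ring
  have h4 : 1 ≤ ρ * q := by rwa [div_le_iff₀ hqpos] at hρ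
  nlinarith [mul_le_mul_of_nonneg_right hv2 (by positivity : (0:ℝ) ≤ 4 * q)]

lemma aux_upper (μ : ℝ) (hμ : 1 < μ) (ω : 𝕋) :
    dimH {t : 𝕋 | {p : ℕ | ‖t + p • ω‖ < (p : ℝ) ^ (-μ)}.Infinite} ≤ ENNReal.ofReal (1 / μ) := by
  apply le_of_forall_gt_imp_ge_of_dense
  intro d hd
  obtain ⟨s, hs1, hs2⟩ := ENNReal.lt_iff_exists_nnreal_btwn.1 hd
  refine le_trans ?_ hs2.le
  have hs : 1 / μ < s := by
    rw [ENNReal.ofReal_lt_iff_lt_toReal (by positivity) (by simp)] at hs1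
    simpa using hs1
  have hsμ : 1 < μ * s := by rwa [div_lt_iff₀' (by positivity)] at hs
  apply dimH_le_of_hausdorffMeasure_ne_top
  have hsum : Summable (fun p : ℕ => (2:ℝ)^(s:ℝ) * (p:ℝ) ^ (-(μ * s))) :=
    (Real.summable_nat_rpow.2 (by linarith)).mul_left _
  have hdiam : ∀ p : ℕ, Metric.ediam (Metric.ball (-(p • ω)) ((p:ℝ)^(-μ))) ≤ ENNReal.ofReal (2 * (p:ℝ)^(-μ)) := by
    intro p
    rw [← Metric.eball_ofReal]
    refine Metric.ediam_eball_le.trans ?_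
    rw [ENNReal.ofReal_mul (by norm_num)]; simp
  have hle := Measure.hausdorffMeasure_le_liminf_tsum (X := 𝕋) (β := ℕ) (ι := fun _ => ℕ) (l := atTop) s
    {t : 𝕋 | {p : ℕ | ‖t + p • ω‖ < (p : ℝ) ^ (-μ)}.Infinite}
    (fun n => ENNReal.ofReal (2 * (n:ℝ)^(-μ))) ?_
    (fun n i => Metric.ball (-((i + n) • ω)) (((i + n : ℕ):ℝ)^(-μ))) ?_ ?_
  · refine ne_top_of_le_ne_top ?_ hle
    refine ne_top_of_le_ne_top ENNReal.zero_ne_top ?_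
    have ht : Tendsto (fun n : ℕ => ∑' i : ℕ, ENNReal.ofReal ((2:ℝ)^(s:ℝ) * ((i + n : ℕ):ℝ) ^ (-(μ * s)))) atTop (𝓝 0) := by
      have := ENNReal.tendsto_sum_nat_add (fun i : ℕ => ENNReal.ofReal ((2:ℝ)^(s:ℝ) * ((i : ℕ):ℝ) ^ (-(μ * s)))) hsum.tsum_ofReal_ne_top
      exact this
    rw [← ht.liminf_eq]
    refine liminf_le_liminf (Eventually.of_forall fun n => ?_)
    refine ENNReal.tsum_le_tsum fun i => ?_
    refine (ENNReal.rpow_le_rpow (hdiam (i+n)) s.2).trans ?_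
    rw [ENNReal.ofReal_rpow_of_nonneg (by positivity) s.2, Real.mul_rpow (by norm_num) (by positivity),
      ← Real.rpow_mul (by positivity)]
    simp
  · have : Tendsto (fun n : ℕ => 2 * (n:ℝ)^(-μ)) atTop (𝓝 (2 * 0)) :=
      ((tendsto_rpow_neg_atTop (by linarith)).comp tendsto_natCast_atTop_atTop).const_mul 2
    have := ENNReal.tendsto_ofReal this
    simpa using this
  · filter_upwards [eventually_gt_atTop 0] with n hn i
    refine (hdiam (i + n)).trans (ENNReal.ofReal_le_ofReal ?_)
    gcongr 2 * ?_
    apply Real.rpow_le_rpow_of_nonpos (by exact_mod_cast hn) (by push_cast; linarith [(Nat.cast_nonneg i : (0:ℝ) ≤ i)]) (by linarith)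
  · refine Eventually.of_forall fun n t ht => ?_
    obtain ⟨p, hp, hnp⟩ := Set.Infinite.exists_gt ht n
    rw [Set.mem_iUnion]
    refine ⟨p - n, ?_⟩
    rw [Nat.sub_add_cancel hnp.le, Metric.mem_ball, dist_eq_norm, sub_neg_eq_add]
    exact hp

lemma aux_vol_univ : (volume : Measure 𝕋) Set.univ = 1 := by simp

lemma aux_prob : IsProbabilityMeasure (volume : Measure 𝕋) := ⟨aux_vol_univ⟩

lemma aux_int (φ : C(𝕋, ℝ)) : Integrable (fun y => φ y) (volume : Measure 𝕋) :=
  φ.continuous.integrable_of_hasCompactSupport (HasCompactSupport.of_compactSpace _)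

lemma aux_intC (φ : C(𝕋, ℂ)) : Integrable (fun y => φ y) (volume : Measure 𝕋) :=
  φ.continuous.integrable_of_hasCompactSupport (HasCompactSupport.of_compactSpace _)

lemma aux_fourier (ω : 𝕋) (hω : ∀ n : ℕ, 0 < n → n • ω ≠ 0) (m : ℤ) (hm : m ≠ 0) :
    fourier m ω ≠ (1:ℂ) := by
  intro h
  rw [fourier_apply] at h
  have h1 : AddCircle.toCircle (m • ω) = AddCircle.toCircle (0 : 𝕋) := by
    rw [AddCircle.toCircle_zero]; exact Circle.ext (by rw [h]; simp)
  have h2 := AddCircle.injective_toCircle one_ne_zero h1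
  rcases Int.natAbs_eq m with h | h
  · apply hω m.natAbs (Int.natAbs_pos.2 hm)
    rw [h] at h2; exact_mod_cast h2
  · apply hω m.natAbs (Int.natAbs_pos.2 hm)
    rw [h] at h2; simpa using h2

lemma aux_integral_fourier (m : ℤ) (hm : m ≠ 0) : ∫ y : 𝕋, fourier m y = 0 :=
  integral_eq_zero_of_add_right_eq_neg (μ := (volume : Measure 𝕋))
    (fourier_add_half_inv_index hm one_pos)

lemma aux_fourier_sum (ω : 𝕋) (hω : ∀ n : ℕ, 0 < n → n • ω ≠ 0) (m : ℤ) (hm : m ≠ 0) (q : ℕ) (z : 𝕋) :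
    ‖∑ p ∈ Finset.Ioc q (2*q), fourier m (z - p • ω)‖ ≤ 2 / ‖fourier m ω - (1:ℂ)‖ := by
  have hne := aux_fourier ω hω m hm
  have hpos : 0 < ‖fourier m ω - (1:ℂ)‖ := norm_pos_iff.2 (sub_ne_zero.2 hne)
  rw [le_div_iff₀ hpos, ← norm_mul, Finset.sum_mul]
  have hn : ∀ x : 𝕋, ‖fourier m x‖ = 1 := fun x => Circle.norm_coe _
  have hstep : ∀ p ∈ Finset.Ico q (2*q), fourier m (z - (p+1) • ω) * (fourier m ω - (1:ℂ)) =
      fourier m (z - p • ω) - fourier m (z - (p+1) • ω) := by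
    intro p _
    have : fourier m (z - p • ω) = fourier m (z - (p+1) • ω) * fourier m ω := by
      have e : z - p • ω = (z - (p+1) • ω) + ω := by rw [succ_nsmul]; abel
      rw [e]
      simp only [fourier_apply, smul_add, AddCircle.toCircle_add, Circle.coe_mul]
    rw [this]; ring
  have hre : ∑ p ∈ Finset.Ioc q (2*q), fourier m (z - p • ω) * (fourier m ω - (1:ℂ)) =
      ∑ p ∈ Finset.Ico q (2*q), fourier m (z - (p+1) • ω) * (fourier m ω - (1:ℂ)) := by
    rw [Finset.sum_Ico_add' (fun p : ℕ => fourier m (z - p • ω) * (fourier m ω - (1:ℂ))) q (2*q) 1]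
    refine Finset.sum_congr ?_ (fun _ _ => rfl)
    ext p; simp only [Finset.mem_Ioc, Finset.mem_Ico]; omega
  rw [hre, Finset.sum_congr rfl hstep, Finset.sum_Ico_eq_sub _ (by omega : q ≤ 2 * q)]
  have ht : ∀ n : ℕ, ∑ p ∈ Finset.range n, (fourier m (z - p • ω) - fourier m (z - (p+1) • ω)) =
     fourier m (z - 0 • ω) - fourier m (z - n • ω) := by
    intro n
    exact Finset.sum_range_sub' (fun p : ℕ => fourier m (z - p • ω)) n
  rw [ht, ht]
  calc _ = ‖fourier m (z - q • ω) - fourier m (z - (2*q) • ω)‖ := by congr 1; ring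
    _ ≤ _ := norm_sub_le _ _
    _ = 2 := by rw [hn, hn]; norm_num

lemma aux_equi (ω : 𝕋) (hω : ∀ n : ℕ, 0 < n → n • ω ≠ 0) (φ : C(𝕋, ℂ)) (ε : ℝ) (hε : 0 < ε) :
    ∀ᶠ q : ℕ in atTop, ∀ z : 𝕋,
      ‖(q:ℂ)⁻¹ * ∑ p ∈ Finset.Ioc q (2*q), φ (z - p • ω) - ∫ y : 𝕋, φ y‖ ≤ ε := by
  have := aux_prob
  have hcl : φ ∈ (Submodule.span ℂ (Set.range <| @fourier 1)).topologicalClosure := by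
    rw [span_fourier_closure_eq_top]; trivial
  have hspan : ∀ ψ ∈ Submodule.span ℂ (Set.range <| @fourier 1), ∀ ε : ℝ, 0 < ε →
     ∀ᶠ q : ℕ in atTop, ∀ z : 𝕋,
      ‖(q:ℂ)⁻¹ * ∑ p ∈ Finset.Ioc q (2*q), ψ (z - p • ω) - ∫ y : 𝕋, ψ y‖ ≤ ε := by
    intro ψ hψ
    induction hψ using Submodule.span_induction with
    | mem x h =>
      intro ε hε
      obtain ⟨m, rfl⟩ := h
      by_cases hm : m = 0
      · subst hm
        filter_upwards [eventually_gt_atTop 0] with q hq z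
        have : (q:ℂ) ≠ 0 := by exact_mod_cast hq.ne'
        simp only [fourier_zero, Finset.sum_const, Nat.card_Ioc]
        rw [show 2 * q - q = q by omega]
        simp [this, hε.le]
      · have ht : Tendsto (fun q : ℕ => (2 / ‖fourier m ω - (1:ℂ)‖) / (q:ℝ)) atTop (𝓝 0) :=
          tendsto_const_div_atTop_nhds_zero_nat _
        filter_upwards [ht.eventually_le_const hε] with q hq z
        rw [aux_integral_fourier m hm, sub_zero, norm_mul]
        refine le_trans ?_ hq
        rw [norm_inv, Complex.norm_natCast, inv_mul_eq_div]
        exact div_le_div_of_nonneg_right (aux_fourier_sum ω hω m hm q z) (by positivity)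
    | zero => intro ε hε; simp [hε.le]
    | add x y hx hy ihx ihy =>
      intro ε hε
      filter_upwards [ihx (ε/2) (by positivity), ihy (ε/2) (by positivity)] with q h1 h2 z
      simp only [ContinuousMap.add_apply, Finset.sum_add_distrib]
      rw [integral_add (aux_intC x) (aux_intC y)]
      calc _ = ‖((q:ℂ)⁻¹ * ∑ p ∈ Finset.Ioc q (2*q), x (z - p • ω) - ∫ a : 𝕋, x a) +
              ((q:ℂ)⁻¹ * ∑ p ∈ Finset.Ioc q (2*q), y (z - p • ω) - ∫ a : 𝕋, y a)‖ := by
              congr 1; ring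
        _ ≤ _ := norm_add_le _ _
        _ ≤ ε := by linarith [h1 z, h2 z]
    | smul a x hx ih =>
      intro ε hε
      filter_upwards [ih (ε/(‖a‖+1)) (by positivity)] with q h1 z
      simp only [ContinuousMap.smul_apply, smul_eq_mul, ← Finset.mul_sum]
      rw [integral_const_mul]
      calc _ = ‖a * ((q:ℂ)⁻¹ * ∑ p ∈ Finset.Ioc q (2*q), x (z - p • ω) - ∫ a : 𝕋, x a)‖ := by
              congr 1; ring
        _ = ‖a‖ * _ := norm_mul _ _
        _ ≤ (‖a‖ + 1) * (ε/(‖a‖+1)) := by gcongr; linarith; exact h1 z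
        _ = ε := by field_simp
  rw [← SetLike.mem_coe, Submodule.topologicalClosure_coe, Metric.mem_closure_iff] at hcl
  obtain ⟨ψ, hψ, hd⟩ := hcl (ε/3) (by positivity)
  have hpt : ∀ y, ‖φ y - ψ y‖ ≤ ε/3 := fun y => by
    rw [← dist_eq_norm]; exact (ContinuousMap.dist_apply_le_dist y).trans hd.le
  filter_upwards [hspan ψ hψ (ε/3) (by positivity), eventually_gt_atTop 0] with q h1 hq z
  have hqpos : (0:ℝ) < q := by exact_mod_cast hq
  have hI : ‖(∫ y : 𝕋, ψ y) - ∫ y : 𝕋, φ y‖ ≤ ε/3 := by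
    rw [← integral_sub (aux_intC ψ) (aux_intC φ)]
    refine (norm_integral_le_of_norm_le_const (C := ε/3) (Eventually.of_forall fun y => ?_)).trans ?_
    · rw [norm_sub_rev]; exact hpt y
    · simp
  have hS : ‖(q:ℂ)⁻¹ * ∑ p ∈ Finset.Ioc q (2*q), (φ (z - p • ω) - ψ (z - p • ω))‖ ≤ ε/3 := by
    rw [norm_mul, norm_inv, Complex.norm_natCast, inv_mul_le_iff₀ hqpos]
    refine (norm_sum_le_of_le _ (fun p _ => hpt _)).trans ?_
    rw [Finset.sum_const, Nat.card_Ioc, show 2 * q - q = q by omega, nsmul_eq_mul]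
  calc _ = ‖(q:ℂ)⁻¹ * ∑ p ∈ Finset.Ioc q (2*q), (φ (z - p • ω) - ψ (z - p • ω)) +
      ((q:ℂ)⁻¹ * ∑ p ∈ Finset.Ioc q (2*q), ψ (z - p • ω) - ∫ y : 𝕋, ψ y) +
      ((∫ y : 𝕋, ψ y) - ∫ y : 𝕋, φ y)‖ := by
        rw [Finset.sum_sub_distrib]; congr 1; ring
    _ ≤ _ := norm_add₃_le
    _ ≤ ε := by linarith [h1 z]

lemma aux_equi_real (ω : 𝕋) (hω : ∀ n : ℕ, 0 < n → n • ω ≠ 0) (φ : C(𝕋, ℝ)) (ε : ℝ) (hε : 0 < ε) :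
    ∀ᶠ q : ℕ in atTop, ∀ z : 𝕋,
      |(q:ℝ)⁻¹ * ∑ p ∈ Finset.Ioc q (2*q), φ (z - p • ω) - ∫ y : 𝕋, φ y| ≤ ε := by
  filter_upwards [aux_equi ω hω ⟨fun y => (φ y : ℂ), by fun_prop⟩ ε hε] with q h z
  have := h z
  simp only [ContinuousMap.coe_mk, integral_complex_ofReal] at this
  rw [← Real.norm_eq_abs, ← Complex.norm_real]
  push_cast
  exact this

lemma aux_bump (r : ℝ) (hr : 0 < r) (hr1 : r ≤ 1/2) : ∃ h : C(𝕋, ℝ), (∀ y, 0 ≤ h y) ∧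
    (∀ y, h y ≤ 2 / r) ∧ (∀ y, h y ≠ 0 → ‖y‖ ≤ r) ∧ ∫ y, h y = 1 := by
  let t : C(𝕋, ℝ) := ⟨fun y => max 0 (1 - ‖y‖ / r), by fun_prop⟩
  have t0 : ∀ y, 0 ≤ t y := fun y => le_max_left _ _
  have t1 : ∀ y, t y ≤ 1 := fun y => max_le zero_le_one (by have : 0 ≤ ‖y‖/r := by positivity
                                                            linarith)
  have hI : r / 2 ≤ ∫ y, t y := by
    have h1 : ∫ y in Metric.closedBall (0:𝕋) (r/2), (1/2 : ℝ) ≤ ∫ y in Metric.closedBall (0:𝕋) (r/2), t y := by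
      apply setIntegral_mono_on (by simp) (aux_int t).integrableOn Metric.isClosed_closedBall.measurableSet
      intro y hy
      rw [mem_closedBall_zero_iff] at hy
      refine le_trans ?_ (le_max_right _ _)
      have : ‖y‖ / r ≤ 1/2 := by rw [div_le_iff₀ hr]; linarith
      linarith
    have h2 : ∫ y in Metric.closedBall (0:𝕋) (r/2), t y ≤ ∫ y, t y :=
      setIntegral_le_integral (aux_int t) (Eventually.of_forall t0)
    refine le_trans ?_ (h1.trans h2)
    rw [setIntegral_const, Measure.real, AddCircle.volume_closedBall, min_eq_right (by linarith),
      ENNReal.toReal_ofReal (by positivity), smul_eq_mul]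
    linarith
  have hIpos : 0 < ∫ y, t y := by linarith
  refine ⟨⟨fun y => t y / ∫ y, t y, by fun_prop⟩, fun y => div_nonneg (t0 y) hIpos.le, ?_, ?_, ?_⟩
  · intro y
    calc _ ≤ 1 / (r/2) := by
            apply div_le_div₀ zero_le_one (t1 y) (by positivity) hI
      _ = _ := by field_simp
  · intro y hy
    by_contra h
    apply hy
    have : t y = 0 := max_eq_left (by
      have : 1 ≤ ‖y‖ / r := by rw [le_div_iff₀ hr]; linarith
      linarith)
    simp [this]
  · simp only [ContinuousMap.coe_mk]
    rw [integral_div, div_self hIpos.ne']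

lemma aux_limit (P : ℕ → ProbabilityMeasure 𝕋) : ∃ ν : ProbabilityMeasure 𝕋,
    ∀ φ : C(𝕋, ℝ), ∀ c : ℝ, (∀ᶠ k in atTop, ∫ y, φ y ∂(P k : Measure 𝕋) ≤ c) →
      ∫ y, φ y ∂(ν : Measure 𝕋) ≤ c := by
  let U : Ultrafilter ℕ := Ultrafilter.of atTop
  have hU : (U : Filter ℕ) ≤ atTop := Ultrafilter.of_le _
  obtain ⟨ν, -, hν⟩ := isCompact_univ.ultrafilter_le_nhds (U.map P) (by simp)
  refine ⟨ν, fun φ c h => ?_⟩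
  have ht : Tendsto P (U : Filter ℕ) (𝓝 ν) := hν
  rw [ProbabilityMeasure.tendsto_iff_forall_integral_tendsto] at ht
  exact le_of_tendsto (ht (BoundedContinuousFunction.mkOfCompact φ)) (hU h)
noncomputable def auxTest (c : 𝕋) (ρ : ℝ) : C(𝕋, ℝ) :=
  ⟨fun y => max 0 (min 1 (2 - ‖y - c‖ / ρ)), by fun_prop⟩

noncomputable def auxG (ω : 𝕋) (q : ℕ) (h : C(𝕋, ℝ)) : C(𝕋, ℝ) :=
  ⟨fun y => (q:ℝ)⁻¹ * ∑ p ∈ Finset.Ioc q (2*q), h (y + p • ω), by fun_prop⟩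

lemma auxTest_nonneg (c : 𝕋) (ρ : ℝ) (y : 𝕋) : 0 ≤ auxTest c ρ y := le_max_left _ _

lemma auxTest_le_one (c : 𝕋) (ρ : ℝ) (y : 𝕋) : auxTest c ρ y ≤ 1 :=
  max_le zero_le_one (min_le_left _ _)

lemma auxTest_eq_one (c : 𝕋) (ρ : ℝ) (hρ : 0 < ρ) (y : 𝕋) (hy : ‖y - c‖ ≤ ρ) : auxTest c ρ y = 1 := by
  have : ‖y - c‖ / ρ ≤ 1 := by rwa [div_le_one hρ]
  change max 0 (min 1 (2 - ‖y - c‖ / ρ)) = 1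
  rw [min_eq_left (by linarith), max_eq_right zero_le_one]

lemma auxTest_eq_zero (c : 𝕋) (ρ : ℝ) (hρ : 0 < ρ) (y : 𝕋) (hy : 2 * ρ < ‖y - c‖) : auxTest c ρ y = 0 := by
  have : 2 ≤ ‖y - c‖ / ρ := by rw [le_div_iff₀ hρ]; exact hy.le
  exact max_eq_left ((min_le_right _ _).trans (by linarith))

lemma auxTest_integral (c : 𝕋) (ρ : ℝ) (hρ : 0 < ρ) : ∫ y, auxTest c ρ y ≤ 4 * ρ := by
  have h1 : ∫ y, auxTest c ρ y = ∫ y in Metric.closedBall c (2*ρ), auxTest c ρ y := by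
    symm
    apply setIntegral_eq_integral_of_forall_compl_eq_zero
    intro y hy
    apply auxTest_eq_zero c ρ hρ
    rwa [Metric.mem_closedBall, dist_eq_norm, not_le] at hy
  rw [h1]
  have h2 : ∫ y in Metric.closedBall c (2*ρ), auxTest c ρ y ≤ ∫ y in Metric.closedBall c (2*ρ), (1:ℝ) :=
    setIntegral_mono (aux_int _).integrableOn (by simp) (fun y => auxTest_le_one c ρ y)
  refine h2.trans ?_
  rw [setIntegral_const, Measure.real, AddCircle.volume_closedBall, smul_eq_mul, mul_one]
  refine (ENNReal.toReal_mono ENNReal.ofReal_ne_top (ENNReal.ofReal_le_ofReal (min_le_right _ _))).trans ?_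
  rw [ENNReal.toReal_ofReal (by positivity)]; linarith

lemma auxG_integral (ω : 𝕋) (q : ℕ) (h φ : C(𝕋, ℝ)) :
    ∫ y, φ y * auxG ω q h y = (q:ℝ)⁻¹ * ∑ p ∈ Finset.Ioc q (2*q), ∫ y, φ y * h (y + p • ω) := by
  have : ∀ y, φ y * auxG ω q h y = (q:ℝ)⁻¹ * ∑ p ∈ Finset.Ioc q (2*q), φ y * h (y + p • ω) := by
    intro y
    simp only [auxG, ContinuousMap.coe_mk, Finset.mul_sum]
    exact Finset.sum_congr rfl fun p _ => by ring
  simp_rw [this]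
  rw [integral_const_mul, integral_finsetSum]
  intro p _
  exact aux_int ⟨fun y => φ y * h (y + p • ω), by fun_prop⟩

lemma auxG_integral' (ω : 𝕋) (q : ℕ) (h φ : C(𝕋, ℝ)) :
    ∫ y, φ y * auxG ω q h y = ∫ z, h z * ((q:ℝ)⁻¹ * ∑ p ∈ Finset.Ioc q (2*q), φ (z - p • ω)) := by
  rw [auxG_integral]
  have : ∀ z, h z * ((q:ℝ)⁻¹ * ∑ p ∈ Finset.Ioc q (2*q), φ (z - p • ω)) =
     (q:ℝ)⁻¹ * ∑ p ∈ Finset.Ioc q (2*q), φ (z - p • ω) * h z := by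
    intro y
    simp only [Finset.mul_sum]
    exact Finset.sum_congr rfl fun p _ => by ring
  simp_rw [this]
  rw [integral_const_mul, integral_finsetSum]
  · congr 1
    refine Finset.sum_congr rfl fun p _ => ?_
    rw [← integral_add_right_eq_self (fun z => φ (z - p • ω) * h z) (p • ω)]
    simp
  intro p _
  exact aux_int ⟨fun y => φ (y - p • ω) * h y, by fun_prop⟩

lemma auxG_close (ω : 𝕋) (q : ℕ) (h φ : C(𝕋, ℝ)) (h0 : ∀ y, 0 ≤ h y) (h1 : ∫ y, h y = 1) (ε : ℝ)
    (hε : ∀ z : 𝕋, |(q:ℝ)⁻¹ * ∑ p ∈ Finset.Ioc q (2*q), φ (z - p • ω) - ∫ y : 𝕋, φ y| ≤ ε) :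
    |(∫ y, φ y * auxG ω q h y) - ∫ y, φ y| ≤ ε := by
  rw [auxG_integral']
  set I := ∫ y, φ y
  let U : C(𝕋, ℝ) := ⟨fun z => (q:ℝ)⁻¹ * ∑ p ∈ Finset.Ioc q (2*q), φ (z - p • ω), by fun_prop⟩
  have e : (∫ z, h z * ((q:ℝ)⁻¹ * ∑ p ∈ Finset.Ioc q (2*q), φ (z - p • ω))) - I = ∫ z, h z * (U z - I) := by
    have : I = ∫ z, h z * I := by rw [integral_mul_const, h1, one_mul]
    conv_lhs => rw [this]
    have i1 : Integrable (fun z => h z * ((q:ℝ)⁻¹ * ∑ p ∈ Finset.Ioc q (2*q), φ (z - p • ω))) (volume : Measure 𝕋) :=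
      aux_int ⟨fun z => h z * ((q:ℝ)⁻¹ * ∑ p ∈ Finset.Ioc q (2*q), φ (z - p • ω)), by fun_prop⟩
    have i2 : Integrable (fun z => h z * I) (volume : Measure 𝕋) := aux_int ⟨fun z => h z * I, by fun_prop⟩
    rw [← integral_sub i1 i2]
    congr 1; ext z; simp only [ContinuousMap.coe_mk, U]; ring
  rw [e]
  calc _ ≤ ∫ z, |h z * (U z - I)| := abs_integral_le_integral_abs
    _ ≤ ∫ z, h z * ε := by
      apply integral_mono (aux_int ⟨fun z => |h z * (U z - I)|, by fun_prop⟩) (aux_int ⟨fun z => h z * ε, by fun_prop⟩)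
      intro z
      simp only [abs_mul, abs_of_nonneg (h0 z), ContinuousMap.coe_mk]
      exact mul_le_mul_of_nonneg_left (hε z) (h0 z)
    _ = ε := by rw [integral_mul_const, h1, one_mul]

lemma auxG_nonneg (ω : 𝕋) (q : ℕ) (h : C(𝕋, ℝ)) (h0 : ∀ y, 0 ≤ h y) (y : 𝕋) : 0 ≤ auxG ω q h y :=
  mul_nonneg (by positivity) (Finset.sum_nonneg fun _ _ => h0 _)

lemma aux_small (ω : 𝕋) (q : ℕ) (hq0 : 0 < q)
    (hq : ∀ m : ℕ, 0 < m → m < q → 1 / (2 * (q:ℝ)) ≤ ‖m • ω‖) (r : ℝ) (hr : 0 < r) (hrq : r ≤ 1 / q)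
    (h f : C(𝕋, ℝ)) (h0 : ∀ y, 0 ≤ h y) (h1 : ∫ y, h y = 1) (h2 : ∀ y, h y ≤ 2 / r)
    (h3 : ∀ y, h y ≠ 0 → ‖y‖ ≤ r) (M : ℝ) (hM : 0 ≤ M) (hf : ∀ y, f y ≤ M)
    (c : 𝕋) (ρ : ℝ) (hρ : 0 < ρ) :
    ∫ y, auxTest c ρ y * f y * auxG ω q h y ≤ 25 * M * max ρ (1/q) * min 1 (8 * ρ / r) := by
  set B := min 1 (8 * ρ / r)
  set ρ' := max ρ (1/(q:ℝ))
  have hB : 0 ≤ B := le_min zero_le_one (by positivity)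
  have hqpos : (0:ℝ) < q := by exact_mod_cast hq0
  have s1 : ∫ y, auxTest c ρ y * f y * auxG ω q h y ≤ M * ∫ y, auxTest c ρ y * auxG ω q h y := by
    rw [← integral_const_mul]
    apply integral_mono (aux_int (auxTest c ρ * f * auxG ω q h))
      ((aux_int (auxTest c ρ * auxG ω q h)).const_mul M)
    intro y
    have := mul_le_mul_of_nonneg_right (hf y) (mul_nonneg (auxTest_nonneg c ρ y) (auxG_nonneg ω q h h0 y))
    simp only [ContinuousMap.mul_apply]
    linarith
  refine s1.trans ?_
  rw [auxG_integral]
  have hterm : ∀ p ∈ Finset.Ioc q (2*q), ∫ y, auxTest c ρ y * h (y + p • ω) ≤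
      if ‖c + p • ω‖ ≤ 3 * ρ' then B else 0 := by
    intro p _
    split_ifs with hc
    · apply le_min
      · have h1' : ∫ y, h (y + p • ω) = 1 := by
          rw [integral_add_right_eq_self (fun y => h y) (p • ω), h1]
        refine le_trans ?_ h1'.le
        apply integral_mono (aux_int ⟨fun y => auxTest c ρ y * h (y + p • ω), by fun_prop⟩)
          (aux_int ⟨fun y => h (y + p • ω), by fun_prop⟩)
        intro y
        exact mul_le_of_le_one_left (h0 _) (auxTest_le_one c ρ y)
      · have : ∫ y, auxTest c ρ y * h (y + p • ω) ≤ ∫ y, auxTest c ρ y * (2 / r) := by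
          apply integral_mono (aux_int ⟨fun y => auxTest c ρ y * h (y + p • ω), by fun_prop⟩)
            ((aux_int (auxTest c ρ)).mul_const _)
          intro y
          exact mul_le_mul_of_nonneg_left (h2 _) (auxTest_nonneg c ρ y)
        refine this.trans ?_
        rw [integral_mul_const]
        calc _ ≤ 4 * ρ * (2 / r) := mul_le_mul_of_nonneg_right (auxTest_integral c ρ hρ) (by positivity)
          _ = _ := by ring
    · apply le_of_eq
      rw [← integral_zero 𝕋 ℝ]
      congr 1
      ext y
      by_contra hne
      obtain ⟨ha, hb⟩ := mul_ne_zero_iff.1 hne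
      have hb' := h3 _ hb
      have ha' : ‖y - c‖ ≤ 2 * ρ := by
        by_contra hcon
        exact ha (auxTest_eq_zero c ρ hρ y (not_le.1 hcon))
      apply hc
      have e : c + p • ω = (y + p • ω) - (y - c) := by abel
      rw [e]
      refine (norm_sub_le _ _).trans ?_
      have := le_max_left ρ (1/(q:ℝ))
      have := le_max_right ρ (1/(q:ℝ))
      linarith
  have hsum := Finset.sum_le_sum hterm
  rw [← Finset.sum_filter, Finset.sum_const, nsmul_eq_mul] at hsum
  have hc := aux_count ω q hq0 hq c ρ' (le_max_right _ _)
  have hfin := hsum.trans (mul_le_mul_of_nonneg_right hc hB)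
  calc _ ≤ M * ((q:ℝ)⁻¹ * (25 * ρ' * q * B)) := by gcongr
    _ = _ := by field_simp

lemma aux_step (μ : ℝ) (hμ : 1 < μ) (ω : 𝕋) (hω : ∀ n : ℕ, 0 < n → n • ω ≠ 0) (s : ℝ) (hs0 : 0 < s)
    (hs : μ * s < 1) (net : ℕ → Finset 𝕋) (f : C(𝕋, ℝ)) (hf : ∀ y, 0 ≤ f y) (ε : ℝ) (hε : 0 < ε) (N : ℕ) :
    ∃ g : C(𝕋, ℝ), (∀ y, 0 ≤ g y) ∧
      (∃ q : ℕ, N < q ∧ ∀ y, g y ≠ 0 → ∃ p ∈ Finset.Ioc q (2*q), ‖y + p • ω‖ ≤ (3 * (q:ℝ)) ^ (-μ)) ∧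
      |(∫ y, f y * g y) - ∫ y, f y| ≤ ε ∧
      ∀ j, ∀ c ∈ net j, ∫ y, auxTest c ((1/2)^j) y * f y * g y ≤
        (∫ y, auxTest c ((1/2)^j) y * f y) + ε * ((1/2:ℝ)^j) ^ s := by
  have hs1 : s < 1 := by nlinarith
  obtain ⟨M, hM, hfM⟩ : ∃ M : ℝ, 0 < M ∧ ∀ y, f y ≤ M :=
    ⟨‖f‖ + 1, by positivity, fun y => (le_abs_self _).trans ((f.norm_coe_le_norm y).trans (by linarith))⟩
  have t1 : Tendsto (fun j : ℕ => 25 * M * (((1/2:ℝ)^j) ^ (1 - s))) atTop (𝓝 0) := by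
    have a : Tendsto (fun j : ℕ => ((1/2:ℝ)^j)) atTop (𝓝 0) :=
      tendsto_pow_atTop_nhds_zero_of_lt_one (by norm_num) (by norm_num)
    have := (a.rpow_const (p := 1 - s) (Or.inr (by linarith))).const_mul (25 * M)
    rwa [Real.zero_rpow (by linarith), mul_zero] at this
  obtain ⟨J, hJ⟩ := eventually_atTop.1 (t1.eventually_le_const hε)
  have t2 : Tendsto (fun q : ℕ => 200 * M * 3 ^ (μ * s) * (q:ℝ) ^ (-(1 - μ * s))) atTop (𝓝 0) := by
    have := ((tendsto_rpow_neg_atTop (y := 1 - μ * s) (by linarith)).comp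
      tendsto_natCast_atTop_atTop).const_mul (200 * M * 3 ^ (μ * s))
    rwa [mul_zero] at this
  have hfin : ∀ᶠ q : ℕ in atTop, ∀ j ∈ Finset.range J, ∀ c ∈ net j, ∀ z : 𝕋,
      |(q:ℝ)⁻¹ * ∑ p ∈ Finset.Ioc q (2*q), (auxTest c ((1/2)^j) * f) (z - p • ω) -
        ∫ y : 𝕋, (auxTest c ((1/2)^j) * f) y| ≤ ε * ((1/2:ℝ)^j) ^ s := by
    rw [Filter.eventually_all_finset]
    intro j _
    rw [Filter.eventually_all_finset]
    intro c _
    exact aux_equi_real ω hω _ _ (by positivity)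
  obtain ⟨N1, hN1⟩ := eventually_atTop.1
    ((aux_equi_real ω hω f ε hε).and (hfin.and (t2.eventually_le_const hε)))
  obtain ⟨q, hqN, hq⟩ := aux_good ω hω (max N N1)
  obtain ⟨e1, e2, e3⟩ := hN1 q ((le_max_right _ _).trans hqN.le)
  have hq0 : 0 < q := by omega
  have hqpos : (0:ℝ) < q := by exact_mod_cast hq0
  have hq1 : (1:ℝ) ≤ q := by exact_mod_cast hq0
  set r := (3 * (q:ℝ)) ^ (-μ) with hr_def
  have hr : 0 < r := by positivity
  have hr1 : r ≤ 1 / (3 * q) := by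
    rw [hr_def, one_div, ← Real.rpow_neg_one]
    exact Real.rpow_le_rpow_of_exponent_le (by linarith) (by linarith)
  have hrq : r ≤ 1 / q := hr1.trans (one_div_le_one_div_of_le hqpos (by linarith))
  have hr2 : r ≤ 1 / 2 := hr1.trans (one_div_le_one_div_of_le (by norm_num) (by linarith))
  obtain ⟨h, h0, h2, h3, h1⟩ := aux_bump r hr hr2
  refine ⟨auxG ω q h, auxG_nonneg ω q h h0, ⟨q, (le_max_left _ _).trans_lt hqN, ?_⟩,
    auxG_close ω q h f h0 h1 ε e1, ?_⟩
  · intro y hy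
    by_contra hcon
    push Not at hcon
    apply hy
    change (q:ℝ)⁻¹ * ∑ p ∈ Finset.Ioc q (2*q), h (y + p • ω) = 0
    rw [Finset.sum_eq_zero, mul_zero]
    intro p hp
    by_contra hne
    exact absurd (h3 _ hne) (not_le.2 (hcon p hp))
  · intro j c hc
    by_cases hj : j < J
    · have := auxG_close ω q h _ h0 h1 _ (e2 j (Finset.mem_range.2 hj) c hc)
      have := (abs_le.1 this).2
      simp only [ContinuousMap.mul_apply] at this
      linarith
    · set ρ : ℝ := (1/2)^j with hρ_def
      have hρ : 0 < ρ := by positivity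
      have hnn : 0 ≤ ∫ y, auxTest c ρ y * f y :=
        integral_nonneg fun y => mul_nonneg (auxTest_nonneg c ρ y) (hf y)
      refine (aux_small ω q hq0 hq r hr hrq h f h0 h1 h2 h3 M hM.le hfM c ρ hρ).trans ?_
      suffices 25 * M * max ρ (1/(q:ℝ)) * min 1 (8 * ρ / r) ≤ ε * ρ ^ s by linarith
      rcases le_total (1/(q:ℝ)) ρ with hle | hle
      · rw [max_eq_left hle]
        have := hJ j (not_lt.1 hj)
        calc _ ≤ 25 * M * ρ * 1 := by gcongr; exact min_le_left _ _
          _ = (25 * M * ρ ^ (1 - s)) * ρ ^ s := by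
            rw [mul_assoc (25 * M) (ρ ^ (1 - s)), ← Real.rpow_add hρ]; simp
          _ ≤ _ := by gcongr
      · rw [max_eq_right hle]
        have hmin : min 1 (8 * ρ / r) ≤ 8 * (ρ / r) ^ s := by
          rcases le_total r ρ with hh | hh
          · have : 1 ≤ (ρ / r) ^ s := Real.one_le_rpow (by rwa [one_le_div hr]) hs0.le
            exact (min_le_left _ _).trans (by linarith)
          · refine (min_le_right _ _).trans ?_
            have : ρ / r ≤ (ρ / r) ^ s := by
              conv_lhs => rw [← Real.rpow_one (ρ / r)]
              exact Real.rpow_le_rpow_of_exponent_ge (by positivity) (by rwa [div_le_one hr]) hs1.le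
            rw [mul_div_assoc]; linarith
        have hrs : r ^ s = (3:ℝ) ^ (-(μ * s)) * (q:ℝ) ^ (-(μ * s)) := by
          rw [hr_def, ← Real.rpow_mul (by positivity), Real.mul_rpow (by norm_num) hqpos.le, neg_mul]
        calc _ ≤ 25 * M * (1 / q) * (8 * (ρ / r) ^ s) := by gcongr
          _ = (200 * M * 3 ^ (μ * s) * (q:ℝ) ^ (-(1 - μ * s))) * ρ ^ s := by
            rw [Real.div_rpow hρ.le hr.le, hrs, show -(1 - μ * s) = μ * s - 1 by ring,
              Real.rpow_sub hqpos, Real.rpow_one, Real.rpow_neg (by norm_num), Real.rpow_neg hqpos.le]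
            field_simp
            norm_num
          _ ≤ _ := by gcongr

lemma aux_seq (μ : ℝ) (hμ : 1 < μ) (ω : 𝕋) (hω : ∀ n : ℕ, 0 < n → n • ω ≠ 0) (s : ℝ) (hs0 : 0 < s)
    (hs : μ * s < 1) (net : ℕ → Finset 𝕋) :
    ∃ (F : ℕ → C(𝕋, ℝ)) (q : ℕ → ℕ), (∀ k y, 0 ≤ F k y) ∧ (∀ k, k < q k) ∧
      (∀ k i y, F (k + 1 + i) y ≠ 0 → ∃ p ∈ Finset.Ioc (q k) (2 * q k),
        ‖y + p • ω‖ ≤ (3 * (q k:ℝ)) ^ (-μ)) ∧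
      (∀ k, 1/2 ≤ ∫ y, F k y) ∧
      ∀ k j, ∀ c ∈ net j, ∫ y, auxTest c ((1/2)^j) y * F k y ≤ 5 * ((1/2:ℝ)^j) ^ s := by
  have hs1 : s < 1 := by nlinarith
  have hpr := aux_prob
  choose G hG0 hGq hGm hGt using fun (f : {f : C(𝕋, ℝ) // ∀ y, 0 ≤ f y}) (k : ℕ) =>
    aux_step μ hμ ω hω s hs0 hs net f.1 f.2 ((1/2)^(k+2)) (by positivity) k
  choose Q hQ1 hQ2 using hGq
  let F : ℕ → {f : C(𝕋, ℝ) // ∀ y, 0 ≤ f y} := fun n => Nat.rec ⟨1, fun y => zero_le_one⟩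
    (fun k f => ⟨f.1 * G f k, fun y => mul_nonneg (f.2 y) (hG0 f k y)⟩) n
  have hF0 : ∀ y, (F 0).1 y = 1 := fun y => rfl
  have hF : ∀ k y, (F (k+1)).1 y = (F k).1 y * G (F k) k y := fun k y => rfl
  clear_value F
  refine ⟨fun k => (F k).1, fun k => Q (F k) k, fun k => (F k).2, fun k => hQ1 _ _, ?_, ?_, ?_⟩
  · intro k i
    induction i with
    | zero =>
      intro y hy
      rw [add_zero, hF] at hy
      exact hQ2 _ _ y (mul_ne_zero_iff.1 hy).2
    | succ i ih =>
      intro y hy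
      rw [← add_assoc, hF] at hy
      exact ih y (mul_ne_zero_iff.1 hy).1
  · have : ∀ k, 1/2 + (1/2)^(k+1) ≤ ∫ y, (F k).1 y := by
      intro k
      induction k with
      | zero => simp [hF0]; norm_num
      | succ k ih =>
        have h1 := (abs_le.1 (hGm (F k) k)).1
        simp_rw [hF]
        have e1 : (1/2:ℝ)^(k+1) = 2 * (1/2)^(k+2) := by ring
        rw [e1] at ih
        change 1/2 + (1/2:ℝ)^(k+2) ≤ _
        linarith
    intro k
    have h2 : (0:ℝ) < (1/2)^(k+1) := by positivity
    linarith [this k]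
  · have : ∀ k j, ∀ c ∈ net j, ∫ y, auxTest c ((1/2)^j) y * (F k).1 y ≤ (5 - (1/2)^k) * ((1/2:ℝ)^j) ^ s := by
      intro k
      induction k with
      | zero =>
        intro j c _
        simp only [hF0, mul_one]
        set ρ : ℝ := (1/2)^j with hρ_def
        have hρ : 0 < ρ := by positivity
        have hρ1 : ρ ≤ 1 := pow_le_one₀ (by norm_num) (by norm_num)
        refine (auxTest_integral c ρ hρ).trans ?_
        have : ρ ≤ ρ ^ s := by
          conv_lhs => rw [← Real.rpow_one ρ]
          exact Real.rpow_le_rpow_of_exponent_ge hρ hρ1 hs1.le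
        norm_num; exact this
      | succ k ih =>
        intro j c hc
        have h1 := hGt (F k) k j c hc
        have h2 := ih j c hc
        simp_rw [hF, ← mul_assoc]
        refine h1.trans ?_
        have e1 : (1/2:ℝ)^k = 4 * (1/2)^(k+2) := by ring
        have e2 : (1/2:ℝ)^(k+1) = 2 * (1/2)^(k+2) := by ring
        rw [e1] at h2
        rw [e2]
        have h3 : (0:ℝ) < (1/2)^(k+2) := by positivity
        have h4 : (0:ℝ) < ((1/2:ℝ)^j) ^ s := by positivity
        nlinarith [mul_pos h3 h4]
    intro k j c hc
    refine (this k j c hc).trans ?_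
    have : (0:ℝ) < (1/2)^k := by positivity
    gcongr; linarith

lemma aux_density (f : C(𝕋, ℝ)) (hf : ∀ y, 0 ≤ f y) (hm : 1/2 ≤ ∫ y, f y) :
    ∃ P : ProbabilityMeasure 𝕋, ∀ φ : C(𝕋, ℝ),
      ∫ y, φ y ∂(P : Measure 𝕋) = (∫ y, φ y * f y) / ∫ y, f y := by
  set m := ∫ y, f y with hm_def
  have hmpos : 0 < m := by linarith
  let P : Measure 𝕋 := volume.withDensity (fun y => ENNReal.ofReal (f y / m))
  have hP : IsProbabilityMeasure P := by
    constructor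
    rw [withDensity_apply _ MeasurableSet.univ, setLIntegral_univ,
      ← ofReal_integral_eq_lintegral_ofReal ((aux_int f).div_const m)
        (Eventually.of_forall fun y => div_nonneg (hf y) hmpos.le), integral_div, div_self hmpos.ne']
    simp
  refine ⟨⟨P, hP⟩, fun φ => ?_⟩
  change ∫ y, φ y ∂P = _
  rw [integral_withDensity_eq_integral_toReal_smul (by fun_prop) (by simp), ← integral_div]
  congr 1
  ext y
  rw [ENNReal.toReal_ofReal (div_nonneg (hf y) hmpos.le), smul_eq_mul]; ring

lemma aux_measure (μ : ℝ) (hμ : 1 < μ) (ω : 𝕋) (hω : ∀ n : ℕ, 0 < n → n • ω ≠ 0) (s : ℝ) (hs0 : 0 < s)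
    (hs : μ * s < 1) (net : ℕ → Finset 𝕋) :
    ∃ ν : ProbabilityMeasure 𝕋, 
      (ν : Measure 𝕋) {t : 𝕋 | {p : ℕ | ‖t + p • ω‖ < (p : ℝ) ^ (-μ)}.Infinite}ᶜ = 0 ∧
      ∀ j, ∀ c ∈ net j, ∫ y, auxTest c ((1/2)^j) y ∂(ν : Measure 𝕋) ≤ 10 * ((1/2:ℝ)^j) ^ s := by
  obtain ⟨F, q, hF0, hq, hsupp, hm, ht⟩ := aux_seq μ hμ ω hω s hs0 hs net
  choose P hP using fun k => aux_density (F k) (hF0 k) (hm k)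
  obtain ⟨ν, hν⟩ := aux_limit P
  refine ⟨ν, ?_, fun j c hc => hν _ _ (Eventually.of_forall fun k => ?_)⟩
  · let E : ℕ → Set 𝕋 := fun k => ⋃ p ∈ Finset.Ioc (q k) (2 * q k),
      {y : 𝕋 | ‖y + p • ω‖ ≤ (3 * (q k:ℝ)) ^ (-μ)}
    have hE : ∀ k, IsClosed (E k) := fun k =>
      (Finset.finite_toSet _).isClosed_biUnion fun p _ => isClosed_le (by fun_prop) continuous_const
    have hE0 : ∀ k, (ν : Measure 𝕋) (E k)ᶜ = 0 := by
      intro k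
      let φ : C(𝕋, ℝ) := ⟨fun y => Metric.infDist y (E k), Metric.continuous_infDist_pt _⟩
      have hφ0 : ∀ y, 0 ≤ φ y := fun y => Metric.infDist_nonneg
      have hφ : ∫ y, φ y ∂(ν : Measure 𝕋) ≤ 0 := by
        apply hν
        filter_upwards [eventually_ge_atTop (k+1)] with n hn
        obtain ⟨i, rfl⟩ := Nat.exists_eq_add_of_le hn
        rw [hP]
        have : ∀ y, φ y * F (k + 1 + i) y = 0 := by
          intro y
          by_cases h : F (k + 1 + i) y = 0
          · rw [h, mul_zero]
          · obtain ⟨p, hp, hp'⟩ := hsupp k i y h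
            have : y ∈ E k := Set.mem_biUnion hp hp'
            have : φ y = 0 := Metric.infDist_zero_of_mem this
            rw [this, zero_mul]
        simp [this]
      have hφe : ∫ y, φ y ∂(ν : Measure 𝕋) = 0 := le_antisymm hφ (integral_nonneg hφ0)
      rw [integral_eq_zero_iff_of_nonneg hφ0
        (φ.continuous.integrable_of_hasCompactSupport (HasCompactSupport.of_compactSpace _))] at hφe
      refine measure_mono_null ?_ hφe
      intro y hy hy0
      apply hy
      by_cases hne : (E k).Nonempty
      · exact ((hE k).mem_iff_infDist_zero hne).2 hy0
      · exfalso
        have h0 := hm (k+1)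
        have : ∀ y, F (k + 1) y = 0 := by
          intro y
          by_contra h
          obtain ⟨p, hp, hp'⟩ := hsupp k 0 y h
          exact hne ⟨y, Set.mem_biUnion hp hp'⟩
        simp [this] at h0
        linarith
    refine measure_mono_null ?_ (measure_iUnion_null hE0)
    intro y hy
    by_contra hcon
    apply hy
    simp only [Set.mem_iUnion, Set.mem_compl_iff, not_exists, not_not] at hcon
    change Set.Infinite _
    rw [Set.infinite_iff_exists_gt]
    intro n
    have := hcon n
    simp only [E, Set.mem_iUnion, Finset.mem_Ioc] at this
    obtain ⟨p, hp, hp'⟩ := this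
    have hqn := hq n
    have hp0 : (0:ℝ) < p := by exact_mod_cast (by omega : 0 < p)
    have hlt : ((3 * q n : ℕ) : ℝ) ^ (-μ) < (p:ℝ) ^ (-μ) := by
      apply Real.rpow_lt_rpow_of_neg hp0 _ (by linarith)
      exact_mod_cast (by omega : p < 3 * q n)
    push_cast at hlt
    refine ⟨p, ?_, by omega⟩
    exact lt_of_le_of_lt hp' hlt
  · rw [hP, div_le_iff₀ (by linarith [hm k])]
    refine (ht k j c hc).trans ?_
    have h4 : (0:ℝ) < ((1/2:ℝ)^j) ^ s := by positivity
    nlinarith [hm k]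

lemma aux_lower (μ : ℝ) (hμ : 1 < μ) (ω : 𝕋) (hω : ∀ n : ℕ, 0 < n → n • ω ≠ 0) (s : ℝ≥0) (hs0 : 0 < s)
    (hs : μ * s < 1) :
    (s : ℝ≥0∞) ≤ dimH {t : 𝕋 | {p : ℕ | ‖t + p • ω‖ < (p : ℝ) ^ (-μ)}.Infinite} := by
  have hs0' : (0:ℝ) < s := hs0
  have hs1 : (s:ℝ) < 1 := by nlinarith
  have hnet : ∀ j : ℕ, ∃ t : Finset 𝕋, ∀ y : 𝕋, ∃ c ∈ t, dist y c < (1/2:ℝ)^j / 2 := by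
    intro j
    obtain ⟨t, -, ht, ht'⟩ := Metric.finite_approx_of_totallyBounded
      (isCompact_univ (X := 𝕋)).totallyBounded ((1/2:ℝ)^j / 2) (by positivity)
    refine ⟨ht.toFinset, fun y => ?_⟩
    have := ht' (Set.mem_univ y)
    simpa using this
  choose net hnet using hnet
  obtain ⟨ν, hν0, hν⟩ := aux_measure μ hμ ω hω s hs0 hs net
  set A := {t : 𝕋 | {p : ℕ | ‖t + p • ω‖ < (p : ℝ) ^ (-μ)}.Infinite}
  have hball : ∀ (S : Set 𝕋) (j : ℕ), Metric.ediam S ≤ ENNReal.ofReal ((1/2:ℝ)^j / 2) →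
      (ν : Measure 𝕋) S ≤ ENNReal.ofReal (10 * ((1/2:ℝ)^j) ^ (s:ℝ)) := by
    intro S j hd
    rcases S.eq_empty_or_nonempty with rfl | ⟨x, hx⟩
    · simp
    obtain ⟨c, hc, hxc⟩ := hnet j x
    set ρ : ℝ := (1/2)^j with hρ_def
    have hρ : 0 < ρ := by positivity
    have hsub : S ⊆ Metric.closedBall c ρ := by
      intro y hy
      have h1 := (Metric.edist_le_ediam_of_mem hy hx).trans hd
      rw [edist_dist, ENNReal.ofReal_le_ofReal_iff (by positivity)] at h1
      have := dist_triangle y x c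
      rw [Metric.mem_closedBall]; linarith
    refine (measure_mono hsub).trans ?_
    have hint : Integrable (fun y => auxTest c ρ y) (ν : Measure 𝕋) :=
      (auxTest c ρ).continuous.integrable_of_hasCompactSupport (HasCompactSupport.of_compactSpace _)
    have h2 : (ν : Measure 𝕋).real (Metric.closedBall c ρ) ≤ ∫ y, auxTest c ρ y ∂(ν : Measure 𝕋) := by
      calc _ = ∫ y in Metric.closedBall c ρ, (1:ℝ) ∂(ν : Measure 𝕋) := by simp
        _ ≤ ∫ y in Metric.closedBall c ρ, auxTest c ρ y ∂(ν : Measure 𝕋) := by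
          apply setIntegral_mono_on (by simp) hint.integrableOn Metric.isClosed_closedBall.measurableSet
          intro y hy
          rw [Metric.mem_closedBall, dist_eq_norm] at hy
          exact (auxTest_eq_one c ρ hρ y hy).ge
        _ ≤ _ := setIntegral_le_integral hint (Eventually.of_forall (auxTest_nonneg c ρ))
    rw [← ENNReal.ofReal_toReal (measure_ne_top (ν : Measure 𝕋) (Metric.closedBall c ρ))]
    exact ENNReal.ofReal_le_ofReal (h2.trans (hν j c hc))
  have hle : (ENNReal.ofReal 40)⁻¹ • (ν : Measure 𝕋) ≤ μH[(s:ℝ)] := by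
    apply Measure.le_hausdorffMeasure _ _ (ENNReal.ofReal (1/4)) (by simp)
    intro S hS
    rw [Measure.smul_apply, smul_eq_mul, ENNReal.inv_mul_le_iff (by simp) (by simp)]
    have hfin : Metric.ediam S ≠ ∞ := ne_top_of_le_ne_top ENNReal.ofReal_ne_top hS
    obtain ⟨d, hd⟩ : ∃ d : ℝ≥0, Metric.ediam S = d := ⟨_, (ENNReal.coe_toNNReal hfin).symm⟩
    have hd4 : (d:ℝ) ≤ 1/4 := by
      rw [hd, ENNReal.le_ofReal_iff_toReal_le (by simp) (by norm_num)] at hS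
      simpa using hS
    rcases eq_or_lt_of_le (show (0:ℝ) ≤ d from d.2) with h0 | h0
    · have hz : (ν : Measure 𝕋) S ≤ 0 := by
        have a : Tendsto (fun j : ℕ => ((1/2:ℝ)^j)) atTop (𝓝 0) :=
          tendsto_pow_atTop_nhds_zero_of_lt_one (by norm_num) (by norm_num)
        have b := (a.rpow_const (p := (s:ℝ)) (Or.inr hs0'.le)).const_mul 10
        rw [Real.zero_rpow hs0'.ne', mul_zero] at b
        have b' := ENNReal.tendsto_ofReal b
        rw [ENNReal.ofReal_zero] at b'
        refine ge_of_tendsto' b' fun j => hball S j ?_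
        rw [hd]
        have : d = 0 := by exact_mod_cast h0.symm
        simp [this]
      exact hz.trans (zero_le)
    · obtain ⟨j, hj1, hj2⟩ := exists_nat_pow_near_of_lt_one (x := 2 * (d:ℝ)) (y := 1/2) (by positivity)
        (by linarith) (by norm_num) (by norm_num)
      refine (hball S j ?_).trans ?_
      · rw [hd, ← ENNReal.ofReal_coe_nnreal]
        exact ENNReal.ofReal_le_ofReal (by linarith)
      · rw [hd, ← ENNReal.ofReal_coe_nnreal, ENNReal.ofReal_rpow_of_pos h0, ← ENNReal.ofReal_mul (by norm_num)]
        apply ENNReal.ofReal_le_ofReal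
        have h5 : (1/2:ℝ)^j ≤ 4 * d := by rw [pow_succ] at hj1; linarith
        calc 10 * ((1/2:ℝ)^j) ^ (s:ℝ) ≤ 10 * (4 * d) ^ (s:ℝ) := by gcongr
          _ = 10 * (4 ^ (s:ℝ) * d ^ (s:ℝ)) := by rw [Real.mul_rpow (by norm_num) h0.le]
          _ ≤ 10 * (4 * d ^ (s:ℝ)) := by
            gcongr
            calc (4:ℝ) ^ (s:ℝ) ≤ 4 ^ (1:ℝ) := Real.rpow_le_rpow_of_exponent_le (by norm_num) hs1.le
              _ = 4 := by simp
          _ = _ := by ring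
  apply le_dimH_of_hausdorffMeasure_ne_zero
  intro hzero
  have hA := hle A
  rw [hzero, Measure.smul_apply, smul_eq_mul, nonpos_iff_eq_zero, mul_eq_zero] at hA
  have hA0 : (ν : Measure 𝕋) A = 0 := hA.resolve_left (by simp)
  have := measure_union_null hA0 hν0
  simp at this

theorem dimH_A_eq (μ : ℝ) (hμ : 1 < μ) (ω : AddCircle (1:ℝ))
    (hω : ∀ n : ℕ, 0 < n → n • ω ≠ 0) :
    dimH {t : AddCircle (1:ℝ) |
        {p : ℕ | ‖t + p • ω‖ < (p : ℝ) ^ (-μ)}.Infinite}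
      = ENNReal.ofReal (1 / μ) := by
  apply le_antisymm (aux_upper μ hμ ω)
  apply le_of_forall_lt_imp_le_of_dense
  intro d hd
  obtain ⟨s, hs1, hs2⟩ := ENNReal.lt_iff_exists_nnreal_btwn.1 hd
  refine hs1.le.trans ?_
  rcases eq_or_lt_of_le (zero_le (a := s)) with h0 | h0
  · simp [← h0]
  apply aux_lower μ hμ ω hω s h0
  rw [ENNReal.lt_ofReal_iff_toReal_lt (by simp)] at hs2
  simp only [ENNReal.coe_toReal] at hs2
  rwa [lt_div_iff₀' (by positivity)] at hs2
end

section
/- For any μ > 1 and any t ∈ ℝ/ℤ, the Hausdorff dimension of the set B_{μ,t} = { ω ∈ ℝ/ℤ : ‖t + pω‖ < p^{−μ} for infinitely many p ∈ ℕ } equals 2/(1+μ). -/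
open scoped ENNReal

lemma cantor_aux (s : ℝ) (C : ℝ) (P : ℕ → ℝ → Prop)
    (r : ℕ → ℝ) (M m : ℕ → ℕ) (c : ℕ → ℕ → ℝ)
    (hr : ∀ k, 0 < r k) (hM0 : 0 < M 0)
    (hr' : ∀ k, r (k+1) ≤ r k / 2)
    (hm : ∀ k, 2 ≤ m k) (hM : ∀ k, M (k+1) = M k * m k)
    (hc : ∀ k n, |c (k+1) n - c k (n / m k)| ≤ r k / 2)
    (hd : ∀ k n n' x x', n < n' → n / m k = n' / m k → |x - c (k+1) n| ≤ r (k+1) →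
      |x' - c (k+1) n'| ≤ r (k+1) →
      ((n':ℝ) - n + 1) / M (k+1) ≤ C * |x' - x| ^ s)
    (hP : ∀ k n x, |x - c (k+1) n| ≤ r (k+1) → P k x) :
    ∃ g : ℝ → ℝ, ∀ z ∈ Set.Ico (0:ℝ) (1 / M 0), |g z - c 0 0| ≤ r 0 ∧ (∀ k, P k (g z)) ∧
      ∀ z' ∈ Set.Ico (0:ℝ) (1 / M 0), z < z' → z' - z ≤ C * |g z' - g z| ^ s := by
  have hMpos : ∀ k, 0 < M k := by
    intro k
    induction k with
    | zero => exact hM0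
    | succ k ih => rw [hM]; exact Nat.mul_pos ih (by have := hm k; omega)
  have hMgrow : ∀ k, 2 ^ k ≤ M k := by
    intro k
    induction k with
    | zero => rw [pow_zero]; exact hM0
    | succ k ih => rw [hM, pow_succ]; exact Nat.mul_le_mul ih (hm k)
  have hpar : ∀ k (z : ℝ), ⌊z * M (k+1)⌋₊ / m k = ⌊z * M k⌋₊ := by
    intro k z
    rw [← Nat.floor_div_natCast, hM]
    congr 1
    have : (m k : ℝ) ≠ 0 := by have := hm k; positivity
    push_cast
    field_simp
  have hex : ∀ z : ℝ, ∃ x, ∀ k, |x - c k ⌊z * M k⌋₊| ≤ r k := by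
    intro z
    have := IsCompact.nonempty_iInter_of_sequence_nonempty_isCompact_isClosed
      (fun k => Metric.closedBall (c k ⌊z * M k⌋₊) (r k)) ?_ ?_ ?_ ?_
    · obtain ⟨x, hx⟩ := this
      refine ⟨x, fun k => ?_⟩
      have := Set.mem_iInter.1 hx k
      rwa [Metric.mem_closedBall, Real.dist_eq] at this
    · intro k
      apply Metric.closedBall_subset_closedBall'
      have := hc k ⌊z * M (k+1)⌋₊
      rw [hpar] at this
      rw [Real.dist_eq]
      linarith [hr' k]
    · intro k
      exact ⟨_, Metric.mem_closedBall_self (hr k).le⟩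
    · exact isCompact_closedBall _ _
    · intro k; exact Metric.isClosed_closedBall
  choose g hg using hex
  refine ⟨g, fun z hz => ?_⟩
  have hz0 : ∀ z ∈ Set.Ico (0:ℝ) (1 / M 0), ⌊z * M 0⌋₊ = 0 := by
    intro z hz
    rw [Nat.floor_eq_zero]
    have : (0:ℝ) < M 0 := by exact_mod_cast hM0
    have := hz.2
    rwa [lt_div_iff₀ ‹_›] at this
  refine ⟨by simpa [hz0 z hz] using hg z 0, fun k => hP k _ _ (hg z (k+1)), fun z' hz' hlt => ?_⟩
  have hdiff : ∃ k, ⌊z * M k⌋₊ ≠ ⌊z' * M k⌋₊ := by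
    by_contra! h
    have hlim : Filter.Tendsto (fun k : ℕ => (1/2:ℝ)^k) Filter.atTop (nhds 0) :=
      tendsto_pow_atTop_nhds_zero_of_lt_one (by norm_num) (by norm_num)
    have : ∀ k : ℕ, z' - z ≤ (1/2:ℝ)^k := by
      intro k
      have hp : (0:ℝ) < M k := by exact_mod_cast hMpos k
      have h1 := Nat.floor_le (mul_nonneg hz.1 hp.le)
      have h2 := Nat.lt_floor_add_one (z' * M k)
      rw [← h k] at h2
      have h3 : (z' - z) * M k ≤ 1 := by nlinarith
      have h4 : (2:ℝ)^k ≤ M k := by exact_mod_cast hMgrow k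
      rw [one_div, inv_pow, ← one_div, le_div_iff₀ (by positivity)]
      nlinarith
    have := ge_of_tendsto' hlim this
    linarith
  classical
  have hk := Nat.find_spec hdiff
  have hmin := fun j => Nat.find_min hdiff (m := j)
  set k := Nat.find hdiff
  rcases Nat.eq_zero_or_pos k with h0 | h0
  · rw [h0, hz0 z hz, hz0 z' hz'] at hk
    exact absurd rfl hk
  obtain ⟨j, hj⟩ := Nat.exists_eq_succ_of_ne_zero h0.ne'
  have hsame := hmin j (by omega)
  push Not at hsame
  rw [hj] at hk
  have hp : (0:ℝ) < M (j+1) := by exact_mod_cast hMpos (j+1)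
  have hle : ⌊z * M (j+1)⌋₊ ≤ ⌊z' * M (j+1)⌋₊ := Nat.floor_mono (by nlinarith)
  have hlt' := lt_of_le_of_ne hle hk
  refine le_trans ?_ (hd j _ _ (g z) (g z') hlt' (by rw [hpar, hpar, hsame]) (hg z (j+1)) (hg z' (j+1)))
  rw [le_div_iff₀ hp]
  have h1 := Nat.floor_le (mul_nonneg hz.1 hp.le)
  have h2 := Nat.lt_floor_add_one (z' * M (j+1))
  nlinarith

lemma dimH_lower_aux (S : Set (AddCircle (1:ℝ))) (s : ℝ) (hs : 0 < s) (C L : ℝ) (hC : 0 ≤ C) (hL : 0 < L)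
    (g : ℝ → ℝ) (hg : ∀ z ∈ Set.Ico (0:ℝ) L, |g z| ≤ 1/4 ∧ ((g z : ℝ) : AddCircle (1:ℝ)) ∈ S ∧
      ∀ z' ∈ Set.Ico (0:ℝ) L, z < z' → z' - z ≤ C * |g z' - g z| ^ s) :
    ENNReal.ofReal s ≤ dimH S := by
  set h : ℝ → AddCircle (1:ℝ) := fun z => (g z : AddCircle (1:ℝ)) with hh
  have hdist : ∀ z ∈ Set.Ico (0:ℝ) L, ∀ z' ∈ Set.Ico (0:ℝ) L, dist (h z') (h z) = |g z' - g z| := by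
    intro z hz z' hz'
    rw [dist_eq_norm, hh]
    simp only
    rw [← AddCircle.coe_sub]
    apply (AddCircle.norm_coe_eq_abs_iff 1 one_ne_zero).2
    have h1 := abs_le.1 (hg z hz).1
    have h2 := abs_le.1 (hg z' hz').1
    rw [abs_one, abs_le]
    constructor <;> linarith
  have hkey : ∀ z ∈ Set.Ico (0:ℝ) L, ∀ z' ∈ Set.Ico (0:ℝ) L, dist z z' ≤ C * dist (h z) (h z') ^ s := by
    intro z hz z' hz'
    rcases lt_trichotomy z z' with hlt | rfl | hlt
    · rw [dist_comm z, dist_comm (h z), hdist z hz z' hz', Real.dist_eq, abs_of_pos (by linarith)]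
      exact (hg z hz).2.2 z' hz' hlt
    · simp [hs.ne']
    · rw [hdist z' hz' z hz, Real.dist_eq, abs_of_pos (by linarith)]
      exact (hg z' hz').2.2 z hz hlt
  have hinj : Set.InjOn h (Set.Ico (0:ℝ) L) := by
    intro z hz z' hz' he
    have := hkey z hz z' hz'
    rw [he, dist_self, Real.zero_rpow hs.ne', mul_zero] at this
    exact dist_le_zero.1 this
  set f := Function.invFunOn h (Set.Ico (0:ℝ) L) with hf
  have hleft : ∀ z ∈ Set.Ico (0:ℝ) L, f (h z) = z := fun z hz => hinj.leftInvOn_invFunOn hz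
  have hhol : HolderOnWith C.toNNReal s.toNNReal f (h '' Set.Ico (0:ℝ) L) := by
    rintro _ ⟨z, hz, rfl⟩ _ ⟨z', hz', rfl⟩
    rw [hleft z hz, hleft z' hz', edist_dist, edist_dist, Real.coe_toNNReal s hs.le,
      ENNReal.ofReal_rpow_of_nonneg dist_nonneg hs.le]
    change _ ≤ ENNReal.ofReal C * _
    rw [← ENNReal.ofReal_mul hC]
    exact ENNReal.ofReal_le_ofReal (hkey z hz z' hz')
  have h1 := hhol.dimH_image_le (by simpa using hs)
  have himg : f '' (h '' Set.Ico (0:ℝ) L) = Set.Ico (0:ℝ) L := by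
    rw [Set.image_image]
    ext w
    constructor
    · rintro ⟨z, hz, rfl⟩; simpa [hleft z hz] using hz
    · intro hw; exact ⟨w, hw, hleft w hw⟩
  rw [himg, Real.dimH_of_nonempty_interior (by rw [interior_Ico]; exact ⟨L/2, by constructor <;> linarith⟩)] at h1
  have h2 : dimH (h '' Set.Ico (0:ℝ) L) ≤ dimH S := dimH_mono (by
    rintro _ ⟨z, hz, rfl⟩; exact (hg z hz).2.1)
  have hs0 : ((s.toNNReal : NNReal) : ℝ≥0∞) ≠ 0 := by simpa using hs
  rw [ENNReal.le_div_iff_mul_le (Or.inl hs0) (Or.inl ENNReal.coe_ne_top), Module.finrank_self, Nat.cast_one, one_mul] at h1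
  exact h1.trans h2

lemma good_approx (τ x : ℝ) (Q : ℕ) (hQ : 0 < Q) (q : ℚ)
    (hq : |x - q| ≤ 1 / ((Q + 1) * q.den)) (hqQ : q.den ≤ Q) (hbig : Q < 8 * q.den) :
    ∃ p : ℕ, Q ≤ p ∧ p < 2 * Q ∧ ∃ a : ℤ, |x - (a - τ) / p| ≤ 24 / (Q:ℝ)^2 := by
  have hd : 0 < q.den := q.pos
  -- solve congruence
  set b := q.num
  set d := q.den
  set w : ℤ := ⌊-τ * d⌋
  have hco : IsCoprime b (d : ℤ) := by
    rw [Int.isCoprime_iff_gcd_eq_one]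
    exact q.reduced
  obtain ⟨u, v, huv⟩ := hco
  -- p ≡ u * w mod d, p in [Q, Q + d)
  set p0 : ℤ := Q + (u * w - Q) % d with hp0
  have hdz : (0:ℤ) < d := by exact_mod_cast hd
  have h1 := Int.emod_nonneg (u * w - Q) hdz.ne'
  have h2 := Int.emod_lt_of_pos (u * w - Q) hdz
  have h3 := Int.mul_ediv_add_emod (u * w - Q) d
  set e := (u * w - Q) / (d:ℤ)
  have hp0eq : p0 = u * w - d * e := by rw [hp0]; linarith
  have hp0pos : 0 ≤ p0 := by positivity
  obtain ⟨p, hp⟩ := Int.eq_ofNat_of_zero_le hp0pos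
  have hQp : Q ≤ p := by omega
  have hpQ : p < 2 * Q := by omega
  refine ⟨p, hQp, hpQ, -(v * w) - e * b, ?_⟩
  -- p * b = w + d * a
  have key : (p:ℤ) * b = w + d * (-(v * w) - e * b) := by
    have : (p:ℤ) = u * w - d * e := by rw [← hp0eq, hp]
    rw [this]
    linear_combination w * huv
  set a : ℤ := -(v * w) - e * b
  have keyR : (p:ℝ) * b = w + d * a := by exact_mod_cast key
  have hdR : (0:ℝ) < d := by exact_mod_cast hd
  have hQR : (0:ℝ) < Q := by exact_mod_cast hQ
  have hQpR : (Q:ℝ) ≤ p := by exact_mod_cast hQp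
  have hpR : (0:ℝ) < p := by linarith
  have hpQR : (p:ℝ) ≤ 2 * Q := by exact_mod_cast hpQ.le
  have hbigR : (Q:ℝ) ≤ 8 * d := by exact_mod_cast hbig.le
  have hqv : (q:ℝ) = b / d := by rw [Rat.cast_def]
  have hw1 := Int.floor_le (-τ * d)
  have hw2 := Int.lt_floor_add_one (-τ * d)
  have hxq : |p * x * d - p * b| ≤ 2 := by
    have : p * x * d - p * b = p * d * (x - q) := by rw [hqv]; field_simp
    rw [this, abs_mul, abs_of_pos (by positivity)]
    calc p * d * |x - q| ≤ p * d * (1 / ((Q + 1) * d)) := by gcongr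
      _ = p / (Q + 1) := by field_simp
      _ ≤ 2 := by rw [div_le_iff₀ (by positivity)]; linarith
  have hfin : |p * d * (x - (a - τ) / p)| ≤ 3 := by
    have : p * d * (x - (a - τ) / p) = (p * x * d - p * b) + (w + τ * d) := by
      rw [keyR]; field_simp; ring
    rw [this]
    refine (abs_add_le _ _).trans ?_
    have : |(w:ℝ) + τ * d| ≤ 1 := by rw [abs_le]; constructor <;> linarith
    linarith
  rw [abs_mul, abs_of_pos (by positivity)] at hfin
  rw [le_div_iff₀ (by positivity)]
  have hA := abs_nonneg (x - (a - τ) / p)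
  have : (Q:ℝ)^2 ≤ 8 * (p * d) := by nlinarith
  nlinarith

open MeasureTheory in
lemma bad_volume_q (x0 ρ : ℝ) (hρ : 0 < ρ) (Q : ℕ) (hQ : 0 < Q) (q : ℕ) (hq : 0 < q) :
    volume {x ∈ Set.Icc (x0 - ρ/2) (x0 + ρ/2) | ∃ b : ℤ, |x - b / q| ≤ 1 / ((Q + 1) * q)}
      ≤ ENNReal.ofReal (2 * ρ / Q + 6 / Q * (q:ℝ)⁻¹) := by
  have hqR : (0:ℝ) < q := by exact_mod_cast hq
  have hq1 : (1:ℝ) ≤ q := by exact_mod_cast hq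
  have hQR : (0:ℝ) < Q := by exact_mod_cast hQ
  set lo : ℤ := ⌈q * (x0 - ρ/2) - 1⌉ with hlo
  set hi : ℤ := ⌊q * (x0 + ρ/2) + 1⌋ with hhi
  have hsub : {x ∈ Set.Icc (x0 - ρ/2) (x0 + ρ/2) | ∃ b : ℤ, |x - b / q| ≤ 1 / ((Q + 1) * q)}
      ⊆ ⋃ b ∈ Finset.Icc lo hi, Metric.closedBall ((b:ℝ)/q) (1 / (Q * q)) := by
    rintro x ⟨⟨hx1, hx2⟩, b, hb⟩
    have hb1 : |q * x - b| ≤ 1 := by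
      have : q * x - b = q * (x - b / q) := by field_simp
      rw [this, abs_mul, abs_of_pos hqR]
      calc q * |x - b/q| ≤ q * (1 / ((Q + 1) * q)) := by gcongr
        _ = 1 / (Q + 1) := by field_simp
        _ ≤ 1 := by rw [div_le_iff₀ (by positivity)]; linarith
    rw [abs_le] at hb1
    simp only [Set.mem_iUnion, Finset.mem_Icc, Metric.mem_closedBall, Real.dist_eq]
    refine ⟨b, ⟨?_, ?_⟩, hb.trans ?_⟩
    · rw [hlo, Int.ceil_le]; nlinarith
    · rw [hhi, Int.le_floor]; nlinarith
    · gcongr; linarith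
  refine (measure_mono hsub).trans ((measure_biUnion_finset_le _ _).trans ?_)
  simp only [Real.volume_closedBall, Finset.sum_const, nsmul_eq_mul]
  rw [← ENNReal.ofReal_natCast, ← ENNReal.ofReal_mul (by positivity)]
  apply ENNReal.ofReal_le_ofReal
  have hcard : ((Finset.Icc lo hi).card : ℝ) ≤ q * ρ + 3 := by
    rw [Int.card_Icc]
    rcases le_total 0 (hi + 1 - lo) with h | h
    · have : (((hi + 1 - lo).toNat : ℤ) : ℝ) = ((hi + 1 - lo : ℤ) : ℝ) := by
        rw [Int.toNat_of_nonneg h]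
      rw [Int.cast_natCast] at this
      rw [this]
      push_cast
      have h1 := Int.le_ceil (q * (x0 - ρ/2) - 1)
      have h2 := Int.floor_le (q * (x0 + ρ/2) + 1)
      linarith
    · rw [Int.toNat_of_nonpos h]; simp; positivity
  calc ((Finset.Icc lo hi).card : ℝ) * (2 * (1 / (Q * q))) ≤ (q * ρ + 3) * (2 * (1 / (Q * q))) := by gcongr
    _ = 2 * ρ / Q + 6 / Q * (q:ℝ)⁻¹ := by field_simp; ring

open MeasureTheory in
lemma bad_volume (x0 ρ : ℝ) (hρ : 0 < ρ) (Q : ℕ) (hQ : 0 < Q)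
    (hlog : 6 * (1 + Real.log Q) / Q ≤ ρ / 4) :
    volume {x ∈ Set.Icc (x0 - ρ/2) (x0 + ρ/2) | ∃ q : ℕ, 0 < q ∧ 8 * q ≤ Q ∧
      ∃ b : ℤ, |x - b / q| ≤ 1 / ((Q + 1) * q)} ≤ ENNReal.ofReal (ρ / 2) := by
  have hQR : (0:ℝ) < Q := by exact_mod_cast hQ
  have hsub : {x ∈ Set.Icc (x0 - ρ/2) (x0 + ρ/2) | ∃ q : ℕ, 0 < q ∧ 8 * q ≤ Q ∧
      ∃ b : ℤ, |x - b / q| ≤ 1 / ((Q + 1) * q)} ⊆ ⋃ q ∈ Finset.Icc 1 (Q / 8),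
      {x ∈ Set.Icc (x0 - ρ/2) (x0 + ρ/2) | ∃ b : ℤ, |x - b / q| ≤ 1 / ((Q + 1) * q)} := by
    rintro x ⟨hx, q, h0, h8, b, hb⟩
    simp only [Set.mem_iUnion, Finset.mem_Icc]
    exact ⟨q, ⟨h0, by omega⟩, hx, b, hb⟩
  refine (measure_mono hsub).trans ((measure_biUnion_finset_le _ _).trans ?_)
  refine (Finset.sum_le_sum (fun q hq => bad_volume_q x0 ρ hρ Q hQ q (Finset.mem_Icc.1 hq).1)).trans ?_
  rw [← ENNReal.ofReal_sum_of_nonneg (fun q _ => by positivity)]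
  apply ENNReal.ofReal_le_ofReal
  rw [Finset.sum_add_distrib, Finset.sum_const, ← Finset.mul_sum, nsmul_eq_mul, Nat.card_Icc]
  have hH : ∑ q ∈ Finset.Icc 1 (Q/8), (q:ℝ)⁻¹ ≤ 1 + Real.log Q := by
    have h1 : ∑ q ∈ Finset.Icc 1 (Q/8), (q:ℝ)⁻¹ ≤ ∑ q ∈ Finset.Icc 1 Q, (q:ℝ)⁻¹ := by
      apply Finset.sum_le_sum_of_subset_of_nonneg
      · exact Finset.Icc_subset_Icc_right (Nat.div_le_self _ _)
      · intros; positivity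
    have h2 := harmonic_le_one_add_log Q
    rw [harmonic_eq_sum_Icc] at h2
    push_cast at h2
    exact h1.trans h2
  have h8 : ((Q / 8 + 1 - 1 : ℕ) : ℝ) ≤ Q / 8 := by
    rw [Nat.add_sub_cancel]; exact_mod_cast Nat.cast_div_le
  calc ((Q / 8 + 1 - 1 : ℕ) : ℝ) * (2 * ρ / Q) + 6 / Q * ∑ q ∈ Finset.Icc 1 (Q/8), (q:ℝ)⁻¹
      ≤ (Q / 8) * (2 * ρ / Q) + 6 / Q * (1 + Real.log Q) := by gcongr
    _ = ρ / 4 + 6 * (1 + Real.log Q) / Q := by field_simp; ring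
    _ ≤ ρ / 2 := by linarith

open MeasureTheory in
lemma separated (G : Set ℝ) (lo hi D : ℝ) (hD : 0 < D) (hG : G ⊆ Set.Icc lo hi) (m : ℕ)
    (hvol : ENNReal.ofReal (2 * m * D) ≤ volume G) :
    ∃ x : ℕ → ℝ, (∀ i < m, x i ∈ G) ∧ ∀ i j, i < j → j < m → ((j:ℝ) - i) * D ≤ x j - x i := by
  classical
  set φ : ℝ → ℤ := fun x => ⌊x / D⌋
  have hfin : (φ '' G).Finite := by
    apply (Set.finite_Icc ⌊lo / D⌋ ⌊hi / D⌋).subset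
    rintro _ ⟨x, hx, rfl⟩
    have := hG hx
    constructor
    · apply Int.floor_mono; gcongr; exact this.1
    · apply Int.floor_mono; gcongr; exact this.2
  set T := hfin.toFinset with hT
  have hcov : G ⊆ ⋃ n ∈ T, Set.Icc (n * D) ((n + 1) * D) := by
    intro x hx
    simp only [Set.mem_iUnion]
    refine ⟨φ x, by rw [hT, Set.Finite.mem_toFinset]; exact ⟨x, hx, rfl⟩, ?_, ?_⟩
    · rw [← le_div_iff₀ hD]; exact Int.floor_le _
    · rw [← div_le_iff₀ hD]; exact (Int.lt_floor_add_one _).le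
  have hcard : 2 * m ≤ T.card := by
    have h1 := hvol.trans ((measure_mono hcov).trans (measure_biUnion_finset_le _ _))
    have h2 : ∀ n : ℤ, volume (Set.Icc (n * D) ((n + 1) * D)) = ENNReal.ofReal D := by
      intro n; rw [Real.volume_Icc]; congr 1; ring
    simp only [h2, Finset.sum_const, nsmul_eq_mul] at h1
    rw [← ENNReal.ofReal_natCast, ← ENNReal.ofReal_mul (by positivity),
      ENNReal.ofReal_le_ofReal_iff (by positivity)] at h1
    have := le_of_mul_le_mul_right h1 hD
    exact_mod_cast this
  set e := T.orderEmbOfFin rfl with he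
  have hstep : ∀ (i j : ℕ) (hi : i < T.card) (hj : j < T.card), i ≤ j → (j:ℤ) - i ≤ e ⟨j, hj⟩ - e ⟨i, hi⟩ := by
    intro i j hi hj hij
    induction j, hij using Nat.le_induction with
    | base => simp
    | succ j hij ih =>
      have h1 := ih (by omega)
      have h2 : e ⟨j, by omega⟩ < e ⟨j+1, hj⟩ := e.strictMono (by simp [Fin.lt_def])
      push_cast
      omega
  have hpre : ∀ i : ℕ, ∃ x, ∀ hi : i < m, x ∈ G ∧ φ x = e ⟨2*i, by omega⟩ := by
    intro i
    by_cases hi : i < m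
    · have : e ⟨2*i, by omega⟩ ∈ T := Finset.orderEmbOfFin_mem _ _ _
      obtain ⟨x, hx, hx'⟩ := hfin.mem_toFinset.1 this
      exact ⟨x, fun _ => ⟨hx, hx'⟩⟩
    · exact ⟨0, fun h => absurd h hi⟩
  choose x hx using hpre
  refine ⟨x, fun i hi => (hx i hi).1, fun i j hij hj => ?_⟩
  have hi : i < m := hij.trans hj
  have h1 := hstep (2*i) (2*j) (by omega) (by omega) (by omega)
  rw [← (hx i hi).2, ← (hx j hj).2] at h1
  have h2 : ((2 * j : ℕ) : ℝ) - (2 * i : ℕ) ≤ (φ (x j) : ℝ) - φ (x i) := by exact_mod_cast h1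
  push_cast at h2
  have h3 : (φ (x j) : ℝ) ≤ x j / D := Int.floor_le _
  have h4 : x i / D < φ (x i) + 1 := Int.lt_floor_add_one _
  have h5 : (i:ℝ) + 1 ≤ j := by exact_mod_cast hij
  have h6 : (j:ℝ) - i ≤ (x j - x i) / D := by rw [sub_div]; linarith
  rwa [le_div_iff₀ hD] at h6

open MeasureTheory in
lemma ubiquity (τ x0 ρ : ℝ) (hρ : 0 < ρ) (Q : ℕ) (hQ : 0 < Q)
    (hlog : 6 * (1 + Real.log Q) / Q ≤ ρ / 4) (hQ2 : 24 / (Q:ℝ)^2 ≤ ρ / 2)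
    (m : ℕ) (hm : (m:ℝ) ≤ ρ * Q^2 / 196) :
    ∃ y : ℕ → ℝ, (∀ i < m, |y i - x0| ≤ ρ ∧ ∃ p : ℕ, Q ≤ p ∧ p < 2 * Q ∧ ∃ a : ℤ, y i = (a - τ) / p) ∧
      ∀ i j, i < j → j < m → ((j:ℝ) - i) / Q^2 ≤ y j - y i := by
  have hQR : (0:ℝ) < Q := by exact_mod_cast hQ
  set I := Set.Icc (x0 - ρ/2) (x0 + ρ/2) with hI
  set bad := {x ∈ I | ∃ q : ℕ, 0 < q ∧ 8 * q ≤ Q ∧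
      ∃ b : ℤ, |x - b / q| ≤ 1 / ((Q + 1) * q)} with hbad
  have hb : volume bad ≤ ENNReal.ofReal (ρ / 2) := bad_volume x0 ρ hρ Q hQ hlog
  have hvol : ENNReal.ofReal (ρ/2) ≤ volume (I \ bad) := by
    have h1 : volume I ≤ volume bad + volume (I \ bad) := by
      refine (measure_mono ?_).trans (measure_union_le _ _)
      intro x hx
      by_cases h : x ∈ bad
      · exact Or.inl h
      · exact Or.inr ⟨hx, h⟩
    have h2 : volume I = ENNReal.ofReal (ρ/2) + ENNReal.ofReal (ρ/2) := by
      rw [hI, Real.volume_Icc, ← ENNReal.ofReal_add (by positivity) (by positivity)]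
      congr 1; ring
    rw [h2] at h1
    have h3 := h1.trans (add_le_add_left hb _)
    exact (ENNReal.add_le_add_iff_left ENNReal.ofReal_ne_top).1 h3
  have hD : 0 < 49 / (Q:ℝ)^2 := by positivity
  obtain ⟨x, hx, hsep⟩ := separated (I \ bad) (x0 - ρ/2) (x0 + ρ/2) (49 / (Q:ℝ)^2) hD
    (fun x hx => hx.1) m (by
      refine le_trans (ENNReal.ofReal_le_ofReal ?_) hvol
      calc 2 * m * (49 / (Q:ℝ)^2) ≤ 2 * (ρ * Q^2 / 196) * (49 / (Q:ℝ)^2) := by gcongr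
        _ = ρ / 2 := by field_simp; norm_num)
  have hex : ∀ i, ∃ y : ℝ, i < m → |x i - y| ≤ 24 / (Q:ℝ)^2 ∧
      ∃ p : ℕ, Q ≤ p ∧ p < 2 * Q ∧ ∃ a : ℤ, y = (a - τ) / p := by
    intro i
    by_cases hi : i < m
    · obtain ⟨hxI, hxb⟩ := hx i hi
      obtain ⟨q, hq1, hq2⟩ := Real.exists_rat_abs_sub_le_and_den_le (x i) hQ
      have hbig : Q < 8 * q.den := by
        by_contra! h
        apply hxb
        refine ⟨hxI, q.den, q.pos, h, q.num, ?_⟩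
        rwa [← Rat.cast_def]
      obtain ⟨p, h1, h2, a, h3⟩ := good_approx τ (x i) Q hQ q hq1 hq2 hbig
      exact ⟨(a - τ) / p, fun _ => ⟨h3, p, h1, h2, a, rfl⟩⟩
    · exact ⟨0, fun h => absurd h hi⟩
  choose y hy using hex
  refine ⟨y, fun i hi => ⟨?_, (hy i hi).2⟩, fun i j hij hj => ?_⟩
  · have h1 := abs_le.1 (hy i hi).1
    have h2 := (hx i hi).1
    rw [hI, Set.mem_Icc] at h2
    rw [abs_le]
    constructor <;> linarith
  · have hi := hij.trans hj
    have h1 := abs_le.1 (hy i hi).1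
    have h2 := abs_le.1 (hy j hj).1
    have h3 := hsep i j hij hj
    have h5 : (i:ℝ) + 1 ≤ j := by exact_mod_cast hij
    have e1 : ((j:ℝ) - i) * (49 / (Q:ℝ)^2) = 49 * (((j:ℝ) - i) / Q^2) := by ring
    have e2 : 24 / (Q:ℝ)^2 ≤ 24 * (((j:ℝ) - i) / Q^2) := by
      rw [← mul_div_assoc]; gcongr; linarith
    linarith

lemma cover_aux (μ : ℝ) (τ : ℝ) (p : ℕ) (hp : 0 < p) (ω : AddCircle (1:ℝ))
    (h : ‖(τ : AddCircle (1:ℝ)) + p • ω‖ < (p : ℝ) ^ (-μ)) :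
    ∃ b : ℕ, b < p ∧ ω ∈ Metric.closedBall (((((b:ℝ) - τ) / p : ℝ)) : AddCircle (1:ℝ)) ((p:ℝ)^(-(1+μ))) := by
  obtain ⟨x, rfl⟩ := QuotientAddGroup.mk_surjective ω
  change ‖(τ : AddCircle (1:ℝ)) + p • (x : AddCircle (1:ℝ))‖ < _ at h
  have hpR : (0:ℝ) < p := by exact_mod_cast hp
  rw [← AddCircle.coe_nsmul, ← AddCircle.coe_add, UnitAddCircle.norm_eq, nsmul_eq_mul] at h
  set a : ℤ := round (τ + p * x)
  have hpz : (0:ℤ) < p := by exact_mod_cast hp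
  refine ⟨(a % p).toNat, ?_, ?_⟩
  · have := Int.emod_lt_of_pos a hpz
    have := Int.emod_nonneg a hpz.ne'
    omega
  · have h0 := Int.emod_nonneg a hpz.ne'
    have hb : (((a % p).toNat : ℕ) : ℝ) = a - p * ((a / p : ℤ) : ℝ) := by
      have h1 : (((a % p).toNat : ℤ)) = a - p * (a / p) := by
        rw [Int.toNat_of_nonneg h0]; linarith [Int.mul_ediv_add_emod a p]
      exact_mod_cast h1
    rw [Metric.mem_closedBall, dist_eq_norm]
    change ‖(x : AddCircle (1:ℝ)) - _‖ ≤ _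
    rw [← AddCircle.coe_sub, UnitAddCircle.norm_eq]
    refine (round_le _ (-(-(a / p : ℤ)))).trans ?_
    have e : x - (((a % p).toNat : ℕ) - τ) / p - ((-(-(a / p : ℤ)) : ℤ) : ℝ) = (τ + p * x - a) / p := by
      rw [hb]; push_cast; field_simp; ring
    rw [e, abs_div, abs_of_pos hpR, div_le_iff₀ hpR, ← Real.rpow_add_one hpR.ne']
    convert h.le using 2
    ring

open MeasureTheory Filter Topology in
lemma upper_aux (μ : ℝ) (hμ : 1 < μ) (τ : ℝ) (s : NNReal) (hs0 : 0 < s) (hs : 2 < s * (1 + μ)) :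
    dimH {ω : AddCircle (1:ℝ) |
        {p : ℕ | ‖(τ : AddCircle (1:ℝ)) + p • ω‖ < (p : ℝ) ^ (-μ)}.Infinite} ≤ s := by
  apply dimH_le_of_hausdorffMeasure_ne_top
  have hs0R : (0:ℝ) < s := by exact_mod_cast hs0
  let U : ℕ → ℕ × ℕ → Set (AddCircle (1:ℝ)) := fun N i =>
    if N < i.1 ∧ i.2 < i.1 then
      Metric.closedBall (((((i.2:ℝ) - τ) / i.1 : ℝ)) : AddCircle (1:ℝ)) ((i.1:ℝ)^(-(1+μ))) else ∅
  let V : ℕ → ℕ → ℝ≥0∞ := fun p b => if b < p then ENNReal.ofReal ((2 * (p:ℝ)^(-(1+μ)))^(s:ℝ)) else 0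
  have hV : ∀ N i, Metric.ediam (U N i) ^ (s:ℝ) ≤ V i.1 i.2 := by
    rintro N ⟨p, b⟩
    simp only [U, V]
    by_cases h : N < p ∧ b < p
    · rw [if_pos h, if_pos h.2, ← ENNReal.ofReal_rpow_of_nonneg (by positivity) hs0R.le]
      gcongr
      refine Metric.ediam_le_of_forall_dist_le fun x hx y hy => ?_
      rw [two_mul]
      exact (dist_triangle_right _ _ _).trans (add_le_add hx hy)
    · rw [if_neg h]; simp [hs0R]
  have hsum : ∑' i : ℕ × ℕ, V i.1 i.2 ≠ ⊤ := by
    rw [ENNReal.tsum_prod]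
    have h1 : ∀ p, ∑' b, V p b = ENNReal.ofReal (2^(s:ℝ) * (p:ℝ)^(1 - s * (1+μ))) := by
      intro p
      rw [tsum_eq_sum (s := Finset.range p) (by intro b hb; simp only [V]; rw [if_neg]; simpa using hb)]
      rw [Finset.sum_congr rfl (g := fun _ => ENNReal.ofReal ((2 * (p:ℝ)^(-(1+μ)))^(s:ℝ)))
        (by intro b hb; simp only [V]; rw [if_pos (by simpa using hb)])]
      rw [Finset.sum_const, Finset.card_range, nsmul_eq_mul, ← ENNReal.ofReal_natCast,
        ← ENNReal.ofReal_mul (by positivity)]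
      congr 1
      rcases Nat.eq_zero_or_pos p with rfl | hp
      · rw [Nat.cast_zero, Real.zero_rpow (x := 1 - s * (1+μ)) (by linarith)]; simp
      · have hpR : (0:ℝ) < p := by exact_mod_cast hp
        rw [Real.mul_rpow (by norm_num) (by positivity), ← Real.rpow_mul hpR.le,
          sub_eq_add_neg, Real.rpow_add hpR, Real.rpow_one]
        ring_nf
    simp only [h1]
    have hsm : Summable (fun p : ℕ => 2^(s:ℝ) * (p:ℝ)^(1 - s * (1+μ))) :=
      (Real.summable_nat_rpow.2 (by linarith)).mul_left _
    rw [← ENNReal.ofReal_tsum_of_nonneg (fun p => by positivity) hsm]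
    exact ENNReal.ofReal_ne_top
  let R : ℕ → ℝ≥0∞ := fun N => ENNReal.ofReal (2 * ((N:ℝ)^(-(1+μ))))
  have hR : Tendsto R atTop (𝓝 0) := by
    rw [← ENNReal.ofReal_zero]
    apply ENNReal.tendsto_ofReal
    have := ((tendsto_rpow_neg_atTop (y := 1+μ) (by linarith)).comp tendsto_natCast_atTop_atTop).const_mul (2:ℝ)
    simpa using this
  have hmain := Measure.hausdorffMeasure_le_liminf_tsum (s:ℝ) {ω : AddCircle (1:ℝ) |
        {p : ℕ | ‖(τ : AddCircle (1:ℝ)) + p • ω‖ < (p : ℝ) ^ (-μ)}.Infinite} (l := atTop) R hR U ?_ ?_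
  · refine ne_top_of_le_ne_top hsum (hmain.trans ?_)
    refine (liminf_le_of_le (by isBoundedDefault) (fun b hb => ?_))
    obtain ⟨N, hN⟩ := hb.exists
    exact hN.trans (ENNReal.tsum_le_tsum (hV N))
  · filter_upwards [eventually_gt_atTop 0] with N hN
    rintro ⟨p, b⟩
    simp only [U, R]
    split_ifs with h
    · refine Metric.ediam_le_of_forall_dist_le fun x hx y hy => ?_
      have hNR : (0:ℝ) < N := by exact_mod_cast hN
      have : (p:ℝ)^(-(1+μ)) ≤ (N:ℝ)^(-(1+μ)) :=
        Real.rpow_le_rpow_of_nonpos hNR (by exact_mod_cast h.1.le) (by linarith)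
      have h2 := (dist_triangle_right x y _).trans (add_le_add hx hy)
      linarith
    · simp
  · filter_upwards with N
    intro ω hω
    obtain ⟨p, hp, hNp⟩ := hω.exists_gt N
    obtain ⟨b, hb, hmem⟩ := cover_aux μ τ p (by omega) ω hp
    refine Set.mem_iUnion.2 ⟨(p, b), ?_⟩
    simp only [U]
    rw [if_pos ⟨hNp, hb⟩]
    exact hmem

open Filter Topology in
lemma large_Q (μ : ℝ) (hμ : 1 < μ) (s : ℝ) (hs2 : s * (1 + μ) < 2) (r : ℝ) (hr : 0 < r) (N : ℕ) :
    ∃ Q : ℕ, 0 < Q ∧ N ≤ Q ∧ 6 * (1 + Real.log Q) / Q ≤ (r/2) / 4 ∧ 24 / (Q:ℝ)^2 ≤ (r/2) / 2 ∧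
      (2 * (Q:ℝ)) ^ (-(1+μ)) ≤ r / 2 ∧ 2 ≤ r * (Q:ℝ)^2 / 784 ∧
      1 ≤ (r * (Q:ℝ)^2 / 784) * ((2 * (Q:ℝ)) ^ (-(1+μ))) ^ s := by
  have hcast : Tendsto (fun Q : ℕ => (Q:ℝ)) atTop atTop := tendsto_natCast_atTop_atTop
  have h2cast : Tendsto (fun Q : ℕ => 2 * (Q:ℝ)) atTop atTop := hcast.const_mul_atTop (by norm_num)
  have hsq : Tendsto (fun Q : ℕ => (Q:ℝ)^2) atTop atTop :=
    (tendsto_pow_atTop (by norm_num)).comp hcast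
  have t1 : Tendsto (fun Q : ℕ => 6 * (1 + Real.log Q) / Q) atTop (𝓝 0) := by
    have h1 : Tendsto (fun x : ℝ => Real.log x / x) atTop (𝓝 0) := by
      simpa using Real.isLittleO_log_id_atTop.tendsto_div_nhds_zero
    have h2 : Tendsto (fun x : ℝ => x⁻¹) atTop (𝓝 0) := tendsto_inv_atTop_zero
    have h3 := (((h2.add h1).const_mul 6).comp hcast)
    simp only [add_zero, mul_zero] at h3
    refine h3.congr fun Q => ?_
    simp only [Function.comp]
    ring
  have t2 : Tendsto (fun Q : ℕ => 24 / (Q:ℝ)^2) atTop (𝓝 0) := hsq.const_div_atTop 24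
  have t3 : Tendsto (fun Q : ℕ => (2 * (Q:ℝ)) ^ (-(1+μ))) atTop (𝓝 0) :=
    (tendsto_rpow_neg_atTop (y := 1+μ) (by linarith)).comp h2cast
  have t4 : Tendsto (fun Q : ℕ => r * (Q:ℝ)^2 / 784) atTop atTop :=
    (hsq.const_mul_atTop hr).atTop_div_const (by norm_num)
  have t5 : Tendsto (fun Q : ℕ => r / 3136 * (2 * (Q:ℝ)) ^ (2 - s * (1+μ))) atTop atTop :=
    ((tendsto_rpow_atTop (by linarith)).comp h2cast).const_mul_atTop (by positivity)
  have := (eventually_gt_atTop 0).and <| (eventually_ge_atTop N).and <|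
    (t1.eventually_le_const (u := (r/2)/4) (by positivity)).and <|
    (t2.eventually_le_const (u := (r/2)/2) (by positivity)).and <|
    (t3.eventually_le_const (u := r/2) (by positivity)).and <|
    (t4.eventually_ge_atTop 2).and (t5.eventually_ge_atTop 1)
  obtain ⟨Q, h0, hN, h1, h2, h3, h4, h5⟩ := this.exists
  refine ⟨Q, h0, hN, h1, h2, h3, h4, h5.trans_eq ?_⟩
  have hQ : (0:ℝ) < 2 * Q := by positivity
  rw [← Real.rpow_mul hQ.le, sub_eq_add_neg, Real.rpow_add hQ]
  have e : (2 * (Q:ℝ)) ^ (2:ℝ) = 4 * (Q:ℝ)^2 := by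
    rw [show (2:ℝ) = ((2:ℕ):ℝ) by norm_num, Real.rpow_natCast]; push_cast; ring
  rw [e, show -(1+μ) * s = -(s * (1+μ)) by ring]
  ring

lemma cantor_step (μ : ℝ) (hμ : 1 < μ) (τ : ℝ) (s : ℝ) (hs : 0 < s) (hs1 : s ≤ 1) (hs2 : s * (1 + μ) < 2)
    (r : ℝ) (M : ℕ) (c : ℕ → ℝ) (N : ℕ) (hr : 0 < r) (hM : 0 < M) (hinv : 1 ≤ M * r ^ s) :
    ∃ (r' : ℝ) (m : ℕ) (c' : ℕ → ℝ), 0 < r' ∧ r' ≤ r / 2 ∧ 2 ≤ m ∧ 1 ≤ ((M * m : ℕ) : ℝ) * r' ^ s ∧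
      (∀ n, |c' n - c (n / m)| ≤ r / 2) ∧
      (∀ n n' x x', n < n' → n / m = n' / m → |x - c' n| ≤ r' → |x' - c' n'| ≤ r' →
        ((n':ℝ) - n + 1) / ((M * m : ℕ) : ℝ) ≤ (2 * 1568 ^ s) * |x' - x| ^ s) ∧
      (∀ n x, |x - c' n| ≤ r' → ∃ p : ℕ, N ≤ p ∧
        ‖(τ : AddCircle (1:ℝ)) + p • (x : AddCircle (1:ℝ))‖ < (p:ℝ) ^ (-μ)) := by
  obtain ⟨Q, hQ, hNQ, h1, h2, h3, h4, h5⟩ := large_Q μ hμ s hs2 r hr N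
  have hQR : (0:ℝ) < Q := by exact_mod_cast hQ
  set r' := (2 * (Q:ℝ)) ^ (-(1+μ)) with hr'
  have hr'0 : 0 < r' := by positivity
  set m := ⌊r / 2 * (Q:ℝ)^2 / 196⌋₊ with hmdef
  have hmle : (m:ℝ) ≤ r / 2 * (Q:ℝ)^2 / 196 := Nat.floor_le (by positivity)
  have hmge : r * (Q:ℝ)^2 / 784 ≤ m := by
    have := Nat.lt_floor_add_one (r / 2 * (Q:ℝ)^2 / 196)
    rw [← hmdef] at this
    linarith
  have hm2 : 2 ≤ m := by exact_mod_cast h4.trans hmge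
  have hmR : (0:ℝ) < m := by positivity
  have hMR : (0:ℝ) < M := by exact_mod_cast hM
  have hM1 : (1:ℝ) ≤ M := by exact_mod_cast hM
  have h4r' : 4 * r' ≤ 1 / (Q:ℝ)^2 := by
    have : r' ≤ (2 * (Q:ℝ)) ^ (-(2:ℝ)) := by
      apply Real.rpow_le_rpow_of_exponent_le
      · have : (1:ℝ) ≤ Q := by exact_mod_cast hQ
        linarith
      · linarith
    have e : (2 * (Q:ℝ)) ^ (-(2:ℝ)) = 1 / (4 * (Q:ℝ)^2) := by
      rw [Real.rpow_neg (by positivity), show (2:ℝ) = ((2:ℕ):ℝ) by norm_num, Real.rpow_natCast]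
      push_cast; rw [one_div]; ring
    rw [e] at this
    calc 4 * r' ≤ 4 * (1 / (4 * (Q:ℝ)^2)) := by gcongr
      _ = 1 / (Q:ℝ)^2 := by field_simp
  choose y hy hysep using fun x0 : ℝ => ubiquity τ x0 (r/2) (by positivity) Q hQ h1 h2 m hmle
  refine ⟨r', m, fun n => y (c (n / m)) (n % m), hr'0, h3, hm2, ?_, ?_, ?_, ?_⟩
  · push_cast
    calc (1:ℝ) ≤ (r * (Q:ℝ)^2 / 784) * r' ^ s := h5
      _ ≤ (M * m) * r' ^ s := by
        gcongr
        nlinarith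
  · intro n
    exact (hy _ _ (Nat.mod_lt _ (by omega))).1
  · intro n n' x x' hlt hpar hx hx'
    simp only at hx hx'
    rw [← hpar] at hx'
    have hmod : n % m < n' % m := by
      have a1 := Nat.div_add_mod n m
      have a2 := Nat.div_add_mod n' m
      rw [← hpar] at a2
      omega
    have hmodlt : n' % m < m := Nat.mod_lt _ (by omega)
    have hsep := hysep (c (n/m)) _ _ hmod hmodlt
    have hj : (n':ℝ) - n = ((n' % m : ℕ):ℝ) - ((n % m : ℕ):ℝ) := by
      have a1 := Nat.div_add_mod n m
      have a2 := Nat.div_add_mod n' m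
      rw [← hpar] at a2
      have b1 : (m:ℝ) * ((n / m : ℕ):ℝ) + ((n % m : ℕ):ℝ) = n := by exact_mod_cast a1
      have b2 : (m:ℝ) * ((n / m : ℕ):ℝ) + ((n' % m : ℕ):ℝ) = n' := by exact_mod_cast a2
      linarith
    rw [← hj] at hsep
    have hjle : (n':ℝ) - n ≤ m := by
      rw [hj]
      have : ((n' % m : ℕ):ℝ) ≤ m := by exact_mod_cast hmodlt.le
      have : (0:ℝ) ≤ ((n % m : ℕ):ℝ) := by positivity
      linarith
    have hj1 : 1 ≤ (n':ℝ) - n := by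
      have : (n:ℝ) + 1 ≤ n' := by exact_mod_cast hlt
      linarith
    set j : ℝ := (n':ℝ) - n
    have hx1 := abs_le.1 hx
    have hx2 := abs_le.1 hx'
    have hq : 1 / (Q:ℝ)^2 ≤ j / (Q:ℝ)^2 := by gcongr
    have hdist : j / (2 * (Q:ℝ)^2) ≤ |x' - x| := by
      refine le_trans ?_ (le_abs_self _)
      have : j / (2 * (Q:ℝ)^2) = (j / (Q:ℝ)^2) / 2 := by field_simp
      rw [this]
      linarith
    have hMinv : 1 / (M:ℝ) ≤ r ^ s := by
      rw [div_le_iff₀ hMR]; linarith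
    have hjm : j / m ≤ (j / m) ^ s := by
      have h01 : j / m ≤ 1 := by rw [div_le_one hmR]; exact hjle
      have := Real.rpow_le_rpow_of_exponent_ge (x := j / m) (by positivity) h01 hs1
      rwa [Real.rpow_one] at this
    push_cast
    calc (j + 1) / (M * m) ≤ (2 * j) / (M * m) := by gcongr; linarith
      _ = 2 * ((1 / M) * (j / m)) := by field_simp
      _ ≤ 2 * (r ^ s * (j / m) ^ s) := by gcongr
      _ = 2 * (r * (j / m)) ^ s := by rw [Real.mul_rpow (by positivity) (by positivity)]
      _ ≤ 2 * (1568 * (j / (2 * (Q:ℝ)^2))) ^ s := by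
        have hbase : r * (j / m) ≤ 1568 * (j / (2 * (Q:ℝ)^2)) := by
          rw [← mul_div_assoc, ← mul_div_assoc, div_le_div_iff₀ (by positivity) (by positivity)]
          have : r * (Q:ℝ)^2 ≤ 784 * m := by linarith
          nlinarith
        have := Real.rpow_le_rpow (by positivity) hbase hs.le
        linarith
      _ = 2 * 1568 ^ s * (j / (2 * (Q:ℝ)^2)) ^ s := by
        rw [Real.mul_rpow (by norm_num) (by positivity)]; ring
      _ ≤ 2 * 1568 ^ s * |x' - x| ^ s := by gcongr
  · intro n x hx
    simp only at hx
    obtain ⟨p, hp1, hp2, a, ha⟩ := (hy (c (n/m)) (n % m) (Nat.mod_lt _ (by omega))).2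
    refine ⟨p, by omega, ?_⟩
    have hpR : (0:ℝ) < p := by exact_mod_cast (by omega : 0 < p)
    rw [← AddCircle.coe_nsmul, ← AddCircle.coe_add, UnitAddCircle.norm_eq, nsmul_eq_mul]
    refine (round_le _ a).trans_lt ?_
    rw [ha] at hx
    have e : τ + p * x - a = p * (x - (a - τ) / p) := by field_simp; ring
    rw [e, abs_mul, abs_of_pos hpR]
    have hlt : r' < (p:ℝ) ^ (-(1+μ)) := by
      apply Real.rpow_lt_rpow_of_neg hpR _ (by linarith)
      exact_mod_cast hp2
    calc p * |x - (a - τ) / p| ≤ p * r' := by gcongr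
      _ < p * (p:ℝ) ^ (-(1+μ)) := by gcongr
      _ = (p:ℝ) ^ (-μ) := by
        rw [mul_comm, ← Real.rpow_add_one hpR.ne']; congr 1; ring

lemma lower_aux (μ : ℝ) (hμ : 1 < μ) (τ : ℝ) (s : ℝ) (hs : 0 < s) (hs1 : s ≤ 1) (hs2 : s * (1 + μ) < 2) :
    ENNReal.ofReal s ≤ dimH {ω : AddCircle (1:ℝ) |
        {p : ℕ | ‖(τ : AddCircle (1:ℝ)) + p • ω‖ < (p : ℝ) ^ (-μ)}.Infinite} := by
  let State := {p : ℝ × ℕ × (ℕ → ℝ) // 0 < p.1 ∧ 0 < p.2.1 ∧ 1 ≤ (p.2.1:ℝ) * p.1 ^ s}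
  have hstep : ∀ (k : ℕ) (S : State), ∃ (S' : State) (m : ℕ), S'.1.1 ≤ S.1.1 / 2 ∧ 2 ≤ m ∧
      S'.1.2.1 = S.1.2.1 * m ∧
      (∀ n, |S'.1.2.2 n - S.1.2.2 (n / m)| ≤ S.1.1 / 2) ∧
      (∀ n n' x x', n < n' → n / m = n' / m → |x - S'.1.2.2 n| ≤ S'.1.1 → |x' - S'.1.2.2 n'| ≤ S'.1.1 →
        ((n':ℝ) - n + 1) / (S'.1.2.1 : ℝ) ≤ (2 * 1568 ^ s) * |x' - x| ^ s) ∧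
      (∀ n x, |x - S'.1.2.2 n| ≤ S'.1.1 → ∃ p : ℕ, k ≤ p ∧
        ‖(τ : AddCircle (1:ℝ)) + p • (x : AddCircle (1:ℝ))‖ < (p:ℝ) ^ (-μ)) := by
    rintro k ⟨⟨r, M, c⟩, hr, hM, hinv⟩
    obtain ⟨r', m, c', a1, a2, a3, a4, a5, a6, a7⟩ :=
      cantor_step μ hμ τ s hs hs1 hs2 r M c k hr hM hinv
    exact ⟨⟨⟨r', M * m, c'⟩, a1, Nat.mul_pos hM (by omega), a4⟩, m, a2, a3, rfl, a5, a6, a7⟩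
  choose F m b1 b2 b3 b4 b5 b6 using hstep
  have hS0 : 1 ≤ ((4:ℕ):ℝ) * (1/4:ℝ) ^ s := by
    have := Real.rpow_le_rpow_of_exponent_ge (x := (1/4:ℝ)) (by norm_num) (by norm_num) hs1
    rw [Real.rpow_one] at this
    push_cast
    linarith
  let S0 : State := ⟨⟨1/4, 4, fun _ => 0⟩, by norm_num, by norm_num, hS0⟩
  let σ : ℕ → State := fun k => Nat.rec S0 (fun k S => F k S) k
  have hσ : ∀ k, σ (k+1) = F k (σ k) := fun k => rfl
  obtain ⟨g, hg⟩ := cantor_aux s (2 * 1568 ^ s)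
    (fun k x => ∃ p : ℕ, k ≤ p ∧ ‖(τ : AddCircle (1:ℝ)) + p • (x : AddCircle (1:ℝ))‖ < (p:ℝ) ^ (-μ))
    (fun k => (σ k).1.1) (fun k => (σ k).1.2.1) (fun k => m k (σ k)) (fun k => (σ k).1.2.2)
    (fun k => (σ k).2.1) (σ 0).2.2.1 (fun k => b1 k (σ k)) (fun k => b2 k (σ k)) (fun k => b3 k (σ k))
    (fun k => b4 k (σ k)) (fun k => b5 k (σ k)) (fun k => b6 k (σ k))
  have hL : (0:ℝ) < 1 / ((σ 0).1.2.1 : ℝ) := by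
    have := (σ 0).2.2.1
    positivity
  refine dimH_lower_aux _ s hs (2 * 1568 ^ s) (1 / ((σ 0).1.2.1 : ℝ)) (by positivity) hL g
    (fun z hz => ?_)
  obtain ⟨c1, c2, c3⟩ := hg z hz
  refine ⟨?_, ?_, c3⟩
  · have : |g z - 0| ≤ 1/4 := c1
    rwa [sub_zero] at this
  · rw [Set.mem_ofPred_eq]
    rw [Set.infinite_iff_exists_gt]
    intro k
    obtain ⟨p, hp, hp'⟩ := c2 (k+1)
    exact ⟨p, hp', by omega⟩

theorem dimH_B_eq (μ : ℝ) (hμ : 1 < μ) (t : AddCircle (1:ℝ)) :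
    dimH {ω : AddCircle (1:ℝ) |
        {p : ℕ | ‖t + p • ω‖ < (p : ℝ) ^ (-μ)}.Infinite}
      = ENNReal.ofReal (2 / (1 + μ)) := by
  obtain ⟨τ, rfl⟩ := QuotientAddGroup.mk_surjective t
  have hμ1 : 0 < 1 + μ := by linarith
  have hd0 : 0 < 2 / (1 + μ) := by positivity
  have hd1 : 2 / (1 + μ) < 1 := by rw [div_lt_one hμ1]; linarith
  apply le_antisymm
  · refine ENNReal.le_of_forall_pos_le_add fun ε hε _ => ?_
    have := upper_aux μ hμ τ ((2 / (1+μ)).toNNReal + ε) (by positivity) (by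
      push_cast
      rw [Real.coe_toNNReal _ hd0.le, add_mul, div_mul_cancel₀ _ hμ1.ne']
      have : (0:ℝ) < ε := by exact_mod_cast hε
      have := mul_pos this hμ1
      linarith)
    exact this
  · refine le_of_forall_lt fun a ha => ?_
    obtain ⟨b, hb1, hb2⟩ := exists_between ha
    have hbtop : b ≠ ⊤ := ne_top_of_lt hb2
    have hb0 : 0 < b.toReal := ENNReal.toReal_pos (ne_bot_of_gt hb1) hbtop
    have hblt : b.toReal < 2 / (1+μ) := by
      rw [ENNReal.lt_ofReal_iff_toReal_lt hbtop] at hb2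
      exact hb2
    have := lower_aux μ hμ τ b.toReal hb0 (by linarith) (by rwa [lt_div_iff₀ hμ1] at hblt)
    rw [ENNReal.ofReal_toReal hbtop] at this
    exact hb1.trans_le this
end

section
/- For any μ > 1, the Hausdorff dimension of the set of ω ∈ ℝ/ℤ such that ‖pω‖ < p^{−μ} for infinitely many p ∈ ℕ equals 2/(1+μ). -/
open scoped ENNReal
open MeasureTheory Metric

theorem jb_large_den {x : ℝ} (hx : Irrational x) (M : ℕ) :
    ∃ q : ℚ, M ≤ q.den ∧ |x - q| < 1 / (q.den : ℝ) ^ 2 := by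
  by_contra! h
  refine Real.infinite_rat_abs_sub_lt_one_div_den_sq_of_irrational hx ?_
  have hfin : ((Set.Icc (-(⌈(|x| + 1) * M⌉)) (⌈(|x| + 1) * M⌉)) ×ˢ (Set.Icc 0 M) :
    Set (ℤ × ℕ)).Finite := (Set.finite_Icc _ _).prod (Set.finite_Icc _ _)
  have hinj : Function.Injective (fun q : ℚ => (q.num, q.den)) := by
    intro a b hab
    simp only [Prod.mk.injEq] at hab
    exact Rat.ext hab.1 hab.2
  refine (hfin.preimage hinj.injOn).subset ?_
  intro q hq
  have hq' : |x - q| < 1 / (q.den : ℝ) ^ 2 := hq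
  have hden : q.den < M := by
    by_contra! hc
    exact absurd hq' (not_lt.mpr (h q hc))
  have hd1 : (1 : ℝ) ≤ q.den := by exact_mod_cast q.pos
  have h1 : 1 / (q.den : ℝ) ^ 2 ≤ 1 := by
    rw [div_le_one (by positivity)]; nlinarith
  have hqa : |(q : ℝ)| ≤ |x| + 1 := by
    have := abs_sub_abs_le_abs_sub (q : ℝ) x
    rw [abs_sub_comm] at this
    linarith
  have hn : |(q.num : ℝ)| ≤ (|x| + 1) * M := by
    have e : (q.num : ℝ) = q * q.den := by
      have := Rat.mul_den_eq_num q
      exact_mod_cast this.symm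
    rw [e, abs_mul, Nat.abs_cast]
    have : (q.den : ℝ) ≤ M := by exact_mod_cast hden.le
    gcongr
  have hn2 : |(q.num : ℝ)| ≤ (⌈(|x| + 1) * M⌉ : ℝ) := hn.trans (Int.le_ceil _)
  rw [abs_le] at hn2
  simp only [Set.mem_preimage, Set.mem_prod, Set.mem_Icc]
  refine ⟨⟨?_, ?_⟩, Nat.zero_le _, hden.le⟩
  · exact_mod_cast hn2.1
  · exact_mod_cast hn2.2

theorem jb_vitali (z R : ℝ) (hR : 0 < R) (N : ℕ) :
    ∃ F : Finset ℚ, (∀ b ∈ F, N ≤ b.den ∧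
        closedBall (b : ℝ) (1 / (b.den : ℝ) ^ 2) ⊆ closedBall z R) ∧
      ((F : Set ℚ).PairwiseDisjoint fun b => closedBall (b : ℝ) (1 / (b.den : ℝ) ^ 2)) ∧
      R / 6 ≤ ∑ b ∈ F, 1 / (b.den : ℝ) ^ 2 := by
  let t : Set ℚ := {b | N ≤ b.den ∧ closedBall (b : ℝ) (1 / (b.den : ℝ) ^ 2) ⊆ closedBall z R}
  have hle1 : ∀ b : ℚ, 1 / (b.den : ℝ) ^ 2 ≤ 1 := by
    intro b
    have hd1 : (1 : ℝ) ≤ b.den := by exact_mod_cast b.pos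
    rw [div_le_one (by positivity)]; nlinarith
  obtain ⟨u, hut, hdis, hcov⟩ := Vitali.exists_disjoint_subfamily_covering_enlargement_closedBall
    t (fun b => (b : ℝ)) (fun b => 1 / (b.den : ℝ) ^ 2) 1 (fun b _ => hle1 b) 5 (by norm_num)
  have hirr : ({x : ℝ | ¬ Irrational x}).Countable := by
    have : {x : ℝ | ¬ Irrational x} = Set.range ((↑) : ℚ → ℝ) := by ext; simp [Irrational]
    rw [this]; exact Set.countable_range _
  have hsub : ball z R \ {x : ℝ | ¬ Irrational x} ⊆
      ⋃ b ∈ u, closedBall (b : ℝ) (5 * (1 / (b.den : ℝ) ^ 2)) := by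
    rintro x ⟨hxb, hxi⟩
    have hxi : Irrational x := not_not.mp hxi
    rw [mem_ball, Real.dist_eq] at hxb
    obtain ⟨M, hM⟩ := exists_nat_gt (2 / (R - |x - z|))
    obtain ⟨q, hq1, hq2⟩ := jb_large_den hxi (max N M)
    have hd1 : (1 : ℝ) ≤ q.den := by exact_mod_cast q.pos
    have hMq : (M : ℝ) ≤ q.den := by exact_mod_cast (le_max_right _ _).trans hq1
    have hpos : 0 < R - |x - z| := by linarith
    have h2 : 2 * (1 / (q.den : ℝ) ^ 2) ≤ R - |x - z| := by
      rw [div_lt_iff₀ hpos] at hM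
      rw [mul_one_div, div_le_iff₀ (by positivity)]
      have : (R - |x - z|) * q.den ≤ (R - |x - z|) * q.den ^ 2 := by
        apply mul_le_mul_of_nonneg_left _ hpos.le
        nlinarith
      nlinarith
    have hqt : q ∈ t := by
      refine ⟨(le_max_left _ _).trans hq1, closedBall_subset_closedBall' ?_⟩
      rw [Real.dist_eq]
      have := abs_sub_le (q : ℝ) x z
      rw [abs_sub_comm (q : ℝ) x] at this
      linarith
    obtain ⟨b, hb, hbs⟩ := hcov q hqt
    refine Set.mem_biUnion hb (hbs ?_)
    rw [mem_closedBall, Real.dist_eq]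
    exact hq2.le
  have hvol : ENNReal.ofReal (2 * R) ≤ ∑' b : u, ENNReal.ofReal (10 * (1 / ((b : ℚ).den : ℝ) ^ 2)) := by
    calc ENNReal.ofReal (2 * R) = volume (ball z R) := (Real.volume_ball z R).symm
      _ = volume (ball z R \ {x : ℝ | ¬ Irrational x}) :=
          (measure_sdiff_null (hirr.measure_zero _)).symm
      _ ≤ _ := measure_mono hsub
      _ ≤ _ := measure_biUnion_le _ u.to_countable _
      _ = _ := by
        congr 1; ext b
        rw [Real.volume_closedBall]; congr 1; ring
  have hlt : ENNReal.ofReal (10 * (R / 6)) <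
      ∑' b : u, ENNReal.ofReal (10 * (1 / ((b : ℚ).den : ℝ) ^ 2)) := by
    refine lt_of_lt_of_le ?_ hvol
    rw [ENNReal.ofReal_lt_ofReal_iff] <;> linarith
  rw [ENNReal.tsum_eq_iSup_sum] at hlt
  obtain ⟨F, hF⟩ := exists_lt_of_lt_ciSup hlt
  refine ⟨F.map (Function.Embedding.subtype _), ?_, ?_, ?_⟩
  · intro b hb
    simp only [Finset.mem_map, Function.Embedding.coe_subtype] at hb
    obtain ⟨a, -, rfl⟩ := hb
    exact hut a.2
  · apply hdis.subset
    intro b hb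
    simp only [Finset.coe_map, Function.Embedding.coe_subtype, Set.mem_image] at hb
    obtain ⟨a, -, rfl⟩ := hb
    exact a.2
  · rw [Finset.sum_map]
    rw [← ENNReal.ofReal_sum_of_nonneg (fun _ _ => by positivity), ← Finset.mul_sum] at hF
    have := (ENNReal.ofReal_lt_ofReal_iff_of_nonneg (by positivity)).mp hF
    simp only [Function.Embedding.coe_subtype]
    linarith

open Classical in
noncomputable def jbphi (s : ℝ) (T : Set ℝ) (r z R : ℝ) : ℝ :=
  if (T ∩ closedBall z R).Nonempty then min 1 (30 * (r / R) ^ s) else 0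

theorem jbphi_nonneg {s : ℝ} {T : Set ℝ} {r z R : ℝ} (hr : 0 ≤ r) (hR : 0 ≤ R) :
    0 ≤ jbphi s T r z R := by
  unfold jbphi; split_ifs <;> positivity

theorem jbphi_le_one {s : ℝ} {T : Set ℝ} {r z R : ℝ} :
    jbphi s T r z R ≤ 1 := by
  unfold jbphi; split_ifs
  · exact min_le_left _ _
  · norm_num

theorem jbphi_le {s : ℝ} {T : Set ℝ} {r z R : ℝ} (hr : 0 ≤ r) (hR : 0 ≤ R) :
    jbphi s T r z R ≤ 30 * (r / R) ^ s := by
  unfold jbphi; split_ifs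
  · exact min_le_right _ _
  · positivity

/-- sum of the radii of disjoint small balls meeting a small set -/
theorem jb_count (F : Finset ℚ) (T : Set ℝ) (r : ℝ) (hr : 0 < r)
    (hT : ∀ x ∈ T, ∀ y ∈ T, |x - y| ≤ r) (ρ : ℚ → ℝ) (hρ : ∀ b, 0 < ρ b)
    (hdis : (F : Set ℚ).PairwiseDisjoint fun b => closedBall (b : ℝ) (ρ b))
    (hhit : ∀ b ∈ F, (T ∩ closedBall (b : ℝ) (ρ b)).Nonempty) (hsmall : ∀ b ∈ F, ρ b ≤ 2 * r) :
    ∑ b ∈ F, ρ b ≤ 5 * r := by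
  rcases F.eq_empty_or_nonempty with rfl | ⟨b0, hb0⟩
  · simp; positivity
  obtain ⟨x0, hx0, -⟩ := hhit b0 hb0
  have hsub : (⋃ b ∈ F, closedBall (b : ℝ) (ρ b)) ⊆ closedBall x0 (5 * r) := by
    refine Set.iUnion₂_subset ?_
    intro b hb
    obtain ⟨y, hy, hyb⟩ := hhit b hb
    refine closedBall_subset_closedBall' ?_
    rw [mem_closedBall, Real.dist_eq] at hyb
    rw [Real.dist_eq]
    have h1 := hT y hy x0 hx0
    have h2 := abs_sub_le (b : ℝ) y x0
    rw [abs_sub_comm (b : ℝ) y] at h2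
    have := hsmall b hb
    linarith
  have h := measure_mono (μ := volume) hsub
  rw [measure_biUnion_finset hdis (fun _ _ => measurableSet_closedBall)] at h
  simp only [Real.volume_closedBall] at h
  rw [← ENNReal.ofReal_sum_of_nonneg (fun b _ => by have := hρ b; positivity), ← Finset.mul_sum,
    ENNReal.ofReal_le_ofReal_iff (by positivity)] at h
  linarith

theorem jb_step (s : ℝ) (hs : 0 < s) (hs1 : s < 1) (z R : ℝ) (hR : 0 < R) (F : Finset ℚ)
    (ρ σ : ℚ → ℝ) (hρ : ∀ b, 0 < ρ b) (hσ : ∀ b, 0 < σ b) (hσρ : ∀ b, σ b ≤ ρ b / 2)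
    (hsub : ∀ b ∈ F, closedBall (b : ℝ) (ρ b) ⊆ closedBall z R)
    (hdis : (F : Set ℚ).PairwiseDisjoint fun b => closedBall (b : ℝ) (ρ b))
    (hW : R / 6 ≤ ∑ b ∈ F, ρ b)
    (hsm : ∀ b ∈ F, 6 * ρ b / R ≤ (σ b / R) ^ s)
    (T : Set ℝ) (r : ℝ) (hr : 0 < r) (hT : ∀ x ∈ T, ∀ y ∈ T, |x - y| ≤ r) :
    ∑ b ∈ F, (ρ b / ∑ b ∈ F, ρ b) * jbphi s T r b (σ b) ≤ jbphi s T r z R := by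
  set W := ∑ b ∈ F, ρ b with hWdef
  have hW0 : 0 < W := lt_of_lt_of_le (by positivity) hW
  have hw1 : ∑ b ∈ F, ρ b / W = 1 := by
    rw [← Finset.sum_div, ← hWdef, div_self hW0.ne']
  have hw0 : ∀ b, 0 ≤ ρ b / W := fun b => by have := hρ b; positivity
  have hwle : ∀ b, ρ b / W ≤ 6 * ρ b / R := by
    intro b
    have := hρ b
    rw [div_le_div_iff₀ hW0 hR]
    nlinarith
  have hsub' : ∀ b : ℚ, closedBall (b : ℝ) (σ b) ⊆ closedBall (b : ℝ) (ρ b) := fun b =>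
    closedBall_subset_closedBall (by have := hσρ b; have := hρ b; linarith)
  by_cases hh : (T ∩ closedBall z R).Nonempty
  swap
  · have : jbphi s T r z R = 0 := by unfold jbphi; rw [if_neg hh]
    rw [this]
    apply le_of_eq
    apply Finset.sum_eq_zero
    intro b hb
    have : ¬ (T ∩ closedBall (b : ℝ) (σ b)).Nonempty := fun h =>
      hh (h.mono (Set.inter_subset_inter_right _ ((hsub' b).trans (hsub b hb))))
    unfold jbphi; rw [if_neg this, mul_zero]
  have hle1 : ∑ b ∈ F, (ρ b / W) * jbphi s T r b (σ b) ≤ 1 := by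
    rw [← hw1]
    exact Finset.sum_le_sum fun b _ => mul_le_of_le_one_right (hw0 b) jbphi_le_one
  rw [show jbphi s T r z R = min 1 (30 * (r / R) ^ s) by unfold jbphi; rw [if_pos hh]]
  refine le_min hle1 ?_
  by_cases hA : ∃ b ∈ F, (T ∩ closedBall (b : ℝ) (σ b)).Nonempty ∧ 2 * r < ρ b
  · obtain ⟨b, hb, ⟨y, hy, hyb⟩, hrb⟩ := hA
    rw [mem_closedBall, Real.dist_eq] at hyb
    rw [Finset.sum_eq_single_of_mem b hb]
    · calc ρ b / W * jbphi s T r b (σ b) ≤ (σ b / R) ^ s * (30 * (r / σ b) ^ s) :=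
            mul_le_mul ((hwle b).trans (hsm b hb)) (jbphi_le hr.le (hσ b).le)
              (jbphi_nonneg hr.le (hσ b).le) (by have := hσ b; positivity)
        _ = 30 * ((σ b / R) * (r / σ b)) ^ s := by
            rw [Real.mul_rpow (by have := hσ b; positivity) (by have := hσ b; positivity)]; ring
        _ = 30 * (r / R) ^ s := by
            congr 2
            have := (hσ b).ne'
            field_simp
    · intro c hc hcb
      have hd := hdis hc hb hcb
      have hd : Disjoint (closedBall (c : ℝ) (ρ c)) (closedBall (b : ℝ) (ρ b)) := hd
      rw [disjoint_closedBall_closedBall_iff (hρ c).le (hρ b).le, Real.dist_eq] at hd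
      have : ¬ (T ∩ closedBall (c : ℝ) (σ c)).Nonempty := by
        rintro ⟨x, hx, hxc⟩
        rw [mem_closedBall, Real.dist_eq] at hxc
        have h1 := abs_sub_le (c : ℝ) x b
        have h2 := abs_sub_le x y b
        have h3 := hT x hx y hy
        rw [abs_sub_comm (c : ℝ) x] at h1
        have := hσρ b
        have := hσρ c
        have := hρ c
        linarith
      unfold jbphi; rw [if_neg this, mul_zero]
  · push Not at hA
    classical
    rcases le_or_gt r R with hrR | hrR
    · set G := F.filter fun b : ℚ => (T ∩ closedBall (b : ℝ) (σ b)).Nonempty with hG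
      have hGF : (G : Set ℚ) ⊆ F := fun b hb => (Finset.mem_filter.mp (Finset.mem_coe.mp hb)).1
      have hcount : ∑ b ∈ G, ρ b ≤ 5 * r := by
        refine jb_count G T r hr hT ρ hρ (hdis.subset hGF) ?_ ?_
        · intro b hb
          exact (Finset.mem_filter.mp hb).2.mono (Set.inter_subset_inter_right _ (hsub' b))
        · intro b hb
          exact hA b (Finset.mem_filter.mp hb).1 (Finset.mem_filter.mp hb).2
      calc ∑ b ∈ F, (ρ b / W) * jbphi s T r b (σ b)
          ≤ ∑ b ∈ F, if (T ∩ closedBall (b : ℝ) (σ b)).Nonempty then ρ b / W else 0 := by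
            refine Finset.sum_le_sum fun b _ => ?_
            split_ifs with h
            · exact mul_le_of_le_one_right (hw0 b) jbphi_le_one
            · unfold jbphi; rw [if_neg h, mul_zero]
        _ = (∑ b ∈ G, ρ b) / W := by
            rw [← Finset.sum_filter, Finset.sum_div]
        _ ≤ 5 * r / (R / 6) := by gcongr
        _ = 30 * (r / R) ^ (1 : ℝ) := by rw [Real.rpow_one]; field_simp; norm_num
        _ ≤ 30 * (r / R) ^ s := by
            have : r / R ≤ 1 := by rw [div_le_one hR]; exact hrR
            have := Real.rpow_le_rpow_of_exponent_ge (by positivity : 0 < r / R) this hs1.le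
            linarith
    · have : 1 ≤ (r / R) ^ s := Real.one_le_rpow (by rw [one_le_div hR]; exact hrR.le) hs.le
      linarith

theorem jb_eventually (μ s R : ℝ) (hR : 0 < R) (hsμ : s * (1 + μ) < 2) :
    ∃ N : ℕ, ∀ n : ℕ, N ≤ n → 1 ≤ n →
      6 * (1 / (n : ℝ) ^ 2) / R ≤ (((n : ℝ) ^ (-(1 + μ)) / 2) / R) ^ s := by
  have ht : Filter.Tendsto (fun n : ℕ => (n : ℝ) ^ (2 - s * (1 + μ))) Filter.atTop Filter.atTop :=
    (tendsto_rpow_atTop (by linarith)).comp tendsto_natCast_atTop_atTop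
  obtain ⟨N, hN⟩ := Filter.eventually_atTop.mp
    (ht.eventually_ge_atTop (6 / R * (2 * R) ^ s))
  refine ⟨N, fun n hn hn1 => ?_⟩
  have h := hN n hn
  have hn0 : (0 : ℝ) < n := by exact_mod_cast hn1
  have e1 : (((n : ℝ) ^ (-(1 + μ)) / 2) / R) ^ s =
      (n : ℝ) ^ (2 - s * (1 + μ)) / ((n : ℝ) ^ 2 * (2 * R) ^ s) := by
    rw [div_div, Real.div_rpow (by positivity) (by positivity), ← Real.rpow_mul hn0.le,
      Real.rpow_sub hn0, show -(1 + μ) * s = -(s * (1 + μ)) by ring, Real.rpow_neg hn0.le,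
      Real.rpow_two]
    have : (0 : ℝ) < (2 * R) ^ s := by positivity
    have : (0 : ℝ) < (n : ℝ) ^ (s * (1 + μ)) := by positivity
    field_simp
  rw [e1, le_div_iff₀ (by positivity)]
  calc 6 * (1 / (n : ℝ) ^ 2) / R * ((n : ℝ) ^ 2 * (2 * R) ^ s) = 6 / R * (2 * R) ^ s := by
        field_simp
    _ ≤ _ := h

theorem jb_child (μ : ℝ) (hμ : 1 < μ) (s : ℝ) (hs : 0 < s) (hsμ : s * (1 + μ) < 2)
    (T : ℕ → Set ℝ) (r : ℕ → ℝ) (hr : ∀ i, 0 < r i)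
    (hT : ∀ i, ∀ x ∈ T i, ∀ y ∈ T i, |x - y| ≤ r i)
    (k : ℕ) (z R : ℝ) (hR : 0 < R)
    (hΦ : ∑' i, ENNReal.ofReal (jbphi s (T i) (r i) z R) < 1) :
    ∃ z' R' : ℝ, 0 < R' ∧ R' ≤ 1 / ((k : ℝ) + 1) ∧ closedBall z' R' ⊆ closedBall z R ∧
      ∑' i, ENNReal.ofReal (jbphi s (T i) (r i) z' R') < 1 ∧
      ∃ q : ℕ, k ≤ q ∧ ∀ x ∈ closedBall z' R', |q * x - round (q * x)| < (q : ℝ) ^ (-μ) := by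
  have hs1 : s < 1 := by nlinarith
  obtain ⟨N, hN⟩ := jb_eventually μ s R hR hsμ
  obtain ⟨F, hF, hdis, hW⟩ := jb_vitali z R hR (max N (k + 1))
  let ρ : ℚ → ℝ := fun b => 1 / (b.den : ℝ) ^ 2
  let σ : ℚ → ℝ := fun b => (b.den : ℝ) ^ (-(1 + μ)) / 2
  have hd0 : ∀ b : ℚ, (0 : ℝ) < b.den := fun b => by exact_mod_cast b.pos
  have hd1 : ∀ b : ℚ, (1 : ℝ) ≤ b.den := fun b => by exact_mod_cast b.pos
  have hρ : ∀ b, 0 < ρ b := fun b => by have := hd0 b; simp only [ρ]; positivity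
  have hσ : ∀ b, 0 < σ b := fun b => by have := hd0 b; simp only [σ]; positivity
  have hσρ : ∀ b, σ b ≤ ρ b / 2 := fun b => by
    simp only [σ, ρ]
    have h : (b.den : ℝ) ^ (-(1 + μ)) ≤ (b.den : ℝ) ^ (-2 : ℝ) :=
      Real.rpow_le_rpow_of_exponent_le (hd1 b) (by linarith)
    rw [Real.rpow_neg (hd0 b).le 2, Real.rpow_two, ← one_div] at h
    linarith
  have hstep := fun i => jb_step s hs hs1 z R hR F ρ σ hρ hσ hσρ (fun b hb => (hF b hb).2) hdis hW
    (fun b hb => hN b.den ((le_max_left _ _).trans (hF b hb).1) b.pos) (T i) (r i) (hr i) (hT i)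
  set W := ∑ b ∈ F, ρ b with hWdef
  have hW0 : 0 < W := lt_of_lt_of_le (by positivity) hW
  have hw0 : ∀ b, 0 ≤ ρ b / W := fun b => by have := hρ b; positivity
  have hw1 : ∑ b ∈ F, ρ b / W = 1 := by
    rw [← Finset.sum_div, ← hWdef, div_self hW0.ne']
  have hex : ∃ b ∈ F, ∑' i, ENNReal.ofReal (jbphi s (T i) (r i) b (σ b)) < 1 := by
    by_contra! hc
    refine absurd hΦ (not_lt.mpr ?_)
    calc (1 : ℝ≥0∞) = ∑ b ∈ F, ENNReal.ofReal (ρ b / W) := by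
          rw [← ENNReal.ofReal_sum_of_nonneg (fun b _ => hw0 b), hw1, ENNReal.ofReal_one]
      _ ≤ ∑ b ∈ F, ENNReal.ofReal (ρ b / W) *
            ∑' i, ENNReal.ofReal (jbphi s (T i) (r i) b (σ b)) :=
          Finset.sum_le_sum fun b hb => le_mul_of_one_le_right' (hc b hb)
      _ = ∑' i, ∑ b ∈ F, ENNReal.ofReal (ρ b / W) *
            ENNReal.ofReal (jbphi s (T i) (r i) b (σ b)) := by
          rw [Summable.tsum_finsetSum (fun _ _ => ENNReal.summable)]
          simp_rw [ENNReal.tsum_mul_left]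
      _ ≤ _ := by
          refine ENNReal.tsum_le_tsum fun i => ?_
          refine le_trans (le_of_eq ?_) (ENNReal.ofReal_le_ofReal (hstep i))
          rw [ENNReal.ofReal_sum_of_nonneg
            (fun b _ => mul_nonneg (hw0 b) (jbphi_nonneg (hr i).le (hσ b).le))]
          exact Finset.sum_congr rfl fun b _ => (ENNReal.ofReal_mul (hw0 b)).symm
  obtain ⟨b, hb, hbΦ⟩ := hex
  have hkb : k + 1 ≤ b.den := (le_max_right _ _).trans (hF b hb).1
  have hkb' : (k : ℝ) + 1 ≤ b.den := by exact_mod_cast hkb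
  refine ⟨b, σ b, hσ b, ?_, ?_, hbΦ, b.den, by omega, ?_⟩
  · have h1 := hσρ b
    have h2 := hρ b
    have h3 : ρ b ≤ 1 / ((k : ℝ) + 1) := by
      simp only [ρ]
      apply one_div_le_one_div_of_le (by positivity)
      have := hd1 b
      nlinarith
    linarith
  · exact (closedBall_subset_closedBall (by have := hσρ b; have := hρ b; linarith)).trans
      (hF b hb).2
  · intro x hx
    rw [mem_closedBall, Real.dist_eq] at hx
    refine lt_of_le_of_lt (round_le _ b.num) ?_
    have e : (b.num : ℝ) = b.den * b := by
      have := Rat.den_mul_eq_num b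
      exact_mod_cast this.symm
    rw [e, ← mul_sub, abs_mul, Nat.abs_cast]
    have h1 : (b.den : ℝ) * (b.den : ℝ) ^ (-(1 + μ)) = (b.den : ℝ) ^ (-μ) := by
      nth_rewrite 1 [← Real.rpow_one (b.den : ℝ)]
      rw [← Real.rpow_add (hd0 b)]; congr 1; ring
    have h2 : (0 : ℝ) < (b.den : ℝ) ^ (-μ) := Real.rpow_pos_of_pos (hd0 b) _
    calc (b.den : ℝ) * |x - b| ≤ b.den * ((b.den : ℝ) ^ (-(1 + μ)) / 2) := by gcongr
      _ = (b.den : ℝ) ^ (-μ) / 2 := by rw [← h1]; ring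
      _ < _ := by linarith

def jbset (μ : ℝ) : Set ℝ :=
  {x : ℝ | {p : ℕ | |p * x - round (p * x)| < (p : ℝ) ^ (-μ)}.Infinite}

theorem jb_nocover (μ : ℝ) (hμ : 1 < μ) (s : ℝ) (hs : 0 < s) (hsμ : s * (1 + μ) < 2)
    (T : ℕ → Set ℝ) (r : ℕ → ℝ) (hr : ∀ i, 0 < r i)
    (hT : ∀ i, ∀ x ∈ T i, ∀ y ∈ T i, |x - y| ≤ r i)
    (z R : ℝ) (hR : 0 < R)
    (hΦ : ∑' i, ENNReal.ofReal (jbphi s (T i) (r i) z R) < 1) :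
    ∃ x ∈ closedBall z R ∩ jbset μ, ∀ i, x ∉ T i := by
  let S := {p : ℝ × ℝ // 0 < p.2 ∧ ∑' i, ENNReal.ofReal (jbphi s (T i) (r i) p.1 p.2) < 1}
  have hch : ∀ (k : ℕ) (p : S), ∃ p' : S, p'.1.2 ≤ 1 / ((k : ℝ) + 1) ∧
      closedBall p'.1.1 p'.1.2 ⊆ closedBall p.1.1 p.1.2 ∧
      ∃ q : ℕ, k ≤ q ∧ ∀ x ∈ closedBall p'.1.1 p'.1.2,
        |q * x - round (q * x)| < (q : ℝ) ^ (-μ) := by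
    rintro k ⟨⟨z, R⟩, hR, hΦ⟩
    obtain ⟨z', R', h1, h2, h3, h4, h5⟩ := jb_child μ hμ s hs hsμ T r hr hT k z R hR hΦ
    exact ⟨⟨(z', R'), h1, h4⟩, h2, h3, h5⟩
  choose f hf1 hf2 hf3 using hch
  let p : ℕ → S := fun n => Nat.rec ⟨(z, R), hR, hΦ⟩ f n
  have hp : ∀ n, p (n + 1) = f n (p n) := fun n => rfl
  obtain ⟨x, hx⟩ := IsCompact.nonempty_iInter_of_sequence_nonempty_isCompact_isClosed
    (fun n => closedBall (p n).1.1 (p n).1.2) (fun n => hf2 n (p n))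
    (fun n => nonempty_closedBall.mpr (p n).2.1.le) (isCompact_closedBall _ _)
    (fun n => isClosed_closedBall)
  rw [Set.mem_iInter] at hx
  refine ⟨x, ⟨hx 0, ?_⟩, ?_⟩
  · show Set.Infinite _
    rw [Set.infinite_iff_exists_gt]
    intro k
    obtain ⟨q, hq, hqx⟩ := hf3 (k + 1) (p (k + 1))
    exact ⟨q, hqx x (hx (k + 2)), by omega⟩
  · intro i hi
    obtain ⟨k, hk⟩ := exists_nat_one_div_lt (hr i)
    have hR0 := (p (k + 1)).2.1
    have hR1 : (p (k + 1)).1.2 ≤ 1 / ((k : ℝ) + 1) := hf1 k (p k)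
    have hlt := (p (k + 1)).2.2
    refine absurd (lt_of_le_of_lt (ENNReal.le_tsum i) hlt) (not_lt.mpr ?_)
    refine le_trans (le_of_eq ENNReal.ofReal_one.symm) (ENNReal.ofReal_le_ofReal ?_)
    have hne : (T i ∩ closedBall (p (k + 1)).1.1 (p (k + 1)).1.2).Nonempty := ⟨x, hi, hx (k + 1)⟩
    unfold jbphi
    rw [if_pos hne]
    have : 1 ≤ (r i / (p (k + 1)).1.2) ^ s :=
      Real.one_le_rpow (by rw [one_le_div hR0]; linarith) hs.le
    exact le_min le_rfl (by linarith)

theorem jb_hausdorff (μ : ℝ) (hμ : 1 < μ) (s : ℝ) (hs : 0 < s) (hsμ : s * (1 + μ) < 2)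
    (z R : ℝ) (hR : 0 < R) : μH[s] (closedBall z R ∩ jbset μ) ≠ 0 := by
  intro h0
  rw [Measure.hausdorffMeasure_apply] at h0
  have h1 := le_of_eq h0
  have h2 := (iSup₂_le_iff.mp h1) 1 one_pos
  set c : ℝ := 30 / R ^ s with hc
  have hc0 : 0 < c := by positivity
  have hε : (0 : ℝ≥0∞) < ENNReal.ofReal (1 / (2 * c)) := by
    rw [ENNReal.ofReal_pos]; positivity
  have h3 := lt_of_le_of_lt h2 hε
  simp only [iInf_lt_iff] at h3
  obtain ⟨T, hcov, hdiam, hsum⟩ := h3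
  obtain ⟨ε, hε0, hεs⟩ := ENNReal.exists_pos_sum_of_countable hε.ne' ℕ
  have hfin : ∀ i, ediam (T i) ≠ ∞ := fun i => ((hdiam i).trans_lt ENNReal.one_lt_top).ne
  let D : ℕ → ℝ := fun i => (ediam (T i)).toReal
  have hD0 : ∀ i, 0 ≤ D i := fun i => ENNReal.toReal_nonneg
  let r : ℕ → ℝ := fun i => (D i ^ s + ε i) ^ (1 / s)
  have hb : ∀ i, 0 < D i ^ s + ε i := fun i => by
    have : (0 : ℝ) < ε i := by exact_mod_cast hε0 i
    have := Real.rpow_nonneg (hD0 i) s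
    linarith
  have hr : ∀ i, 0 < r i := fun i => Real.rpow_pos_of_pos (hb i) _
  have hrs : ∀ i, r i ^ s = D i ^ s + ε i := fun i => by
    simp only [r]
    rw [← Real.rpow_mul (hb i).le, one_div_mul_cancel hs.ne', Real.rpow_one]
  have hDr : ∀ i, D i ≤ r i := fun i => by
    rw [← Real.rpow_le_rpow_iff (hD0 i) (hr i).le hs, hrs]
    have : (0 : ℝ) < ε i := by exact_mod_cast hε0 i
    linarith
  have hT : ∀ i, ∀ x ∈ T i, ∀ y ∈ T i, |x - y| ≤ r i := by
    intro i x hx y hy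
    refine le_trans ?_ (hDr i)
    rw [← Real.dist_eq, dist_edist]
    exact ENNReal.toReal_mono (hfin i) (edist_le_ediam_of_mem hx hy)
  obtain ⟨x, hx, hxT⟩ := jb_nocover μ hμ s hs hsμ T r hr hT z R hR (by
    calc ∑' i, ENNReal.ofReal (jbphi s (T i) (r i) z R)
        ≤ ∑' i, ENNReal.ofReal c * (ediam (T i) ^ s + ε i) := by
          refine ENNReal.tsum_le_tsum fun i => ?_
          refine (ENNReal.ofReal_le_ofReal (jbphi_le (hr i).le hR.le)).trans (le_of_eq ?_)
          rw [Real.div_rpow (hr i).le hR.le, hrs, show 30 * ((D i ^ s + ε i) / R ^ s) =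
            c * (D i ^ s + ε i) by rw [hc]; ring, ENNReal.ofReal_mul hc0.le,
            ENNReal.ofReal_add (Real.rpow_nonneg (hD0 i) s) (NNReal.coe_nonneg _),
            ENNReal.ofReal_coe_nnreal, ← ENNReal.ofReal_rpow_of_nonneg (hD0 i) hs.le,
            ENNReal.ofReal_toReal (hfin i)]
      _ = ENNReal.ofReal c * (∑' i, ediam (T i) ^ s + ∑' i, (ε i : ℝ≥0∞)) := by
          rw [ENNReal.tsum_mul_left, ENNReal.tsum_add]
      _ < ENNReal.ofReal c * (ENNReal.ofReal (1 / (2 * c)) + ENNReal.ofReal (1 / (2 * c))) := by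
          refine ENNReal.mul_lt_mul_right (by simpa using hc0) ENNReal.ofReal_ne_top ?_
          refine ENNReal.add_lt_add ?_ hεs
          refine lt_of_le_of_lt (ENNReal.tsum_le_tsum fun i => ?_) hsum
          rcases (T i).eq_empty_or_nonempty with h | h
          · simp [h, hs]
          · exact le_iSup_of_le h le_rfl
      _ = 1 := by
          rw [← ENNReal.ofReal_add (by positivity) (by positivity), ← ENNReal.ofReal_mul hc0.le,
            ← ENNReal.ofReal_one]
          congr 1
          field_simp
          norm_num)
  obtain ⟨i, hi⟩ := Set.mem_iUnion.mp (hcov hx)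
  exact hxT i hi

theorem jb_mem (μ : ℝ) (x : ℝ) : (x : AddCircle (1 : ℝ)) ∈ {ω : AddCircle (1:ℝ) |
        {p : ℕ | ‖p • ω‖ < (p : ℝ) ^ (-μ)}.Infinite} ↔ x ∈ jbset μ := by
  have : ∀ p : ℕ, ‖p • (x : AddCircle (1 : ℝ))‖ = |p * x - round (p * x)| := by
    intro p
    rw [← AddCircle.coe_nsmul, nsmul_eq_mul]
    exact UnitAddCircle.norm_eq
  simp only [Set.mem_ofPred_eq, this, jbset]

theorem jb_lower (μ : ℝ) (hμ : 1 < μ) :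
    ENNReal.ofReal (2 / (1 + μ)) ≤ dimH {ω : AddCircle (1:ℝ) |
        {p : ℕ | ‖p • ω‖ < (p : ℝ) ^ (-μ)}.Infinite} := by
  set E := {ω : AddCircle (1:ℝ) | {p : ℕ | ‖p • ω‖ < (p : ℝ) ^ (-μ)}.Infinite} with hE
  have hiso : Isometry (fun x : closedBall (0 : ℝ) (1 / 4) => ((x : ℝ) : AddCircle (1 : ℝ))) := by
    refine Isometry.of_dist_eq ?_
    rintro ⟨x, hx⟩ ⟨y, hy⟩
    rw [mem_closedBall, Real.dist_eq, sub_zero] at hx hy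
    rw [dist_eq_norm, ← AddCircle.coe_sub, Subtype.dist_eq, Real.dist_eq,
      AddCircle.norm_coe_eq_abs_iff 1 one_ne_zero, abs_one]
    have := abs_sub x y
    linarith
  have h1 := hiso.antilipschitz.dimH_preimage_le E
  have h2 : dimH (closedBall (0 : ℝ) (1 / 4) ∩ jbset μ) ≤ dimH E := by
    rw [← (isometry_subtype_coe (s := closedBall (0 : ℝ) (1 / 4))).dimH_image] at h1
    refine le_trans (dimH_mono ?_) h1
    rintro x ⟨hx, hxj⟩
    exact ⟨⟨x, hx⟩, (jb_mem μ x).mpr hxj, rfl⟩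
  refine le_trans ?_ h2
  refine ENNReal.le_of_forall_nnreal_lt fun d hd => ?_
  rcases eq_or_lt_of_le (show 0 ≤ d from d.2) with h | h
  · simp [← h]
  refine le_dimH_of_hausdorffMeasure_ne_zero (jb_hausdorff μ hμ d h ?_ 0 (1 / 4) (by norm_num))
  rw [← ENNReal.ofReal_coe_nnreal, ENNReal.ofReal_lt_ofReal_iff (by positivity)] at hd
  rwa [lt_div_iff₀ (by linarith)] at hd

theorem jb_upper (μ : ℝ) (hμ : 1 < μ) :
    dimH {ω : AddCircle (1:ℝ) |
        {p : ℕ | ‖p • ω‖ < (p : ℝ) ^ (-μ)}.Infinite} ≤ ENNReal.ofReal (2 / (1 + μ)) := by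
  set E := {ω : AddCircle (1:ℝ) | {p : ℕ | ‖p • ω‖ < (p : ℝ) ^ (-μ)}.Infinite} with hE
  have hlip : LipschitzWith 1 (fun x : ℝ => (x : AddCircle (1 : ℝ))) := by
    refine LipschitzWith.of_dist_le_mul fun x y => ?_
    rw [dist_eq_norm, ← AddCircle.coe_sub, UnitAddCircle.norm_eq, NNReal.coe_one, one_mul,
      Real.dist_eq]
    simpa using round_le (x - y) 0
  have h1 : dimH E ≤ dimH (Set.Ico (0 : ℝ) 1 ∩ jbset μ) := by
    refine le_trans (dimH_mono ?_) (hlip.dimH_image_le _)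
    intro ω hω
    obtain ⟨x, hx, rfl⟩ : ∃ x ∈ Set.Ico (0 : ℝ) 1, (x : AddCircle (1 : ℝ)) = ω := by
      have : Fact ((0 : ℝ) < 1) := ⟨one_pos⟩
      refine ⟨AddCircle.equivIco 1 0 ω, ?_, AddCircle.coe_equivIco⟩
      have := (AddCircle.equivIco 1 0 ω).2
      simpa using this
    exact ⟨x, ⟨hx, (jb_mem μ x).mp hω⟩, rfl⟩
  refine h1.trans ?_
  refine le_of_forall_gt_imp_ge_of_dense fun a ha => ?_
  rcases eq_or_ne a ∞ with rfl | hatop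
  · exact le_top
  lift a to NNReal using hatop
  rw [← ENNReal.ofReal_coe_nnreal, ENNReal.ofReal_lt_ofReal_iff_of_nonneg (by positivity),
    div_lt_iff₀ (by linarith)] at ha
  apply dimH_le_of_hausdorffMeasure_ne_top
  obtain ⟨d, hd⟩ : ∃ d : ℝ, d = (a : ℝ) := ⟨_, rfl⟩
  have hdn : 0 ≤ d := hd ▸ a.2
  rw [← hd] at ha ⊢
  have hd0 : 0 < d := by
    by_contra! hc
    have : d = 0 := le_antisymm hc hdn
    rw [this] at ha; linarith
  let g : ℕ → ℝ := fun p => ((p : ℝ) + 1) * (2 * (p : ℝ) ^ (-(1 + μ))) ^ d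
  have hg0 : ∀ p, 0 ≤ g p := fun p => by simp only [g]; positivity
  have hg : Summable g := by
    have hs : Summable fun p : ℕ => (2 * 2 ^ d) * (p : ℝ) ^ (1 - d * (1 + μ)) :=
      (Real.summable_nat_rpow.mpr (by linarith)).mul_left _
    refine Summable.of_nonneg_of_le hg0 (fun p => ?_) hs
    simp only [g]
    rcases Nat.eq_zero_or_pos p with rfl | hp
    · rw [Nat.cast_zero, Real.zero_rpow (by linarith : -(1 + μ) ≠ 0), mul_zero,
        Real.zero_rpow hd0.ne', mul_zero]
      positivity
    · have hp1 : (1 : ℝ) ≤ p := by exact_mod_cast hp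
      have hp0 : (0 : ℝ) < p := by linarith
      rw [Real.mul_rpow (by norm_num) (by positivity), ← Real.rpow_mul hp0.le,
        sub_eq_add_neg, Real.rpow_add hp0, Real.rpow_one,
        show -(1 + μ) * d = -(d * (1 + μ)) by ring]
      have : (0 : ℝ) < 2 ^ d * (p : ℝ) ^ (-(d * (1 + μ))) := by positivity
      nlinarith
  have hrad : Filter.Tendsto (fun n : ℕ => ENNReal.ofReal (2 * ((n : ℝ) + 1) ^ (-(1 + μ))))
      Filter.atTop (nhds 0) := by
    rw [← ENNReal.ofReal_zero]
    apply ENNReal.tendsto_ofReal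
    have h := ((tendsto_rpow_neg_atTop (by linarith : 0 < 1 + μ)).comp
      (Filter.tendsto_atTop_add_const_right _ (1 : ℝ) tendsto_natCast_atTop_atTop)).const_mul 2
    simpa using h
  have hball : ∀ x r : ℝ, ediam (closedBall x r) = ENNReal.ofReal (2 * r) := by
    intro x r
    rw [Real.closedBall_eq_Icc, Real.ediam_Icc]; congr 1; ring
  have hmain := Measure.hausdorffMeasure_le_liminf_tsum (β := ℕ)
    (ι := fun n => Σ p : ℕ, Fin (p + (n + 1) + 1)) d (Set.Ico (0 : ℝ) 1 ∩ jbset μ)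
    (l := Filter.atTop) (fun n : ℕ => ENNReal.ofReal (2 * ((n : ℝ) + 1) ^ (-(1 + μ)))) hrad
    (fun n i => closedBall (((i.2 : ℕ) : ℝ) / ((i.1 + (n + 1) : ℕ) : ℝ))
      (((i.1 + (n + 1) : ℕ) : ℝ) ^ (-(1 + μ)))) ?_ ?_
  · refine ne_top_of_le_ne_top (b := ∑' p, ENNReal.ofReal (g p)) ?_ ?_
    · rw [← ENNReal.ofReal_tsum_of_nonneg hg0 hg]; exact ENNReal.ofReal_ne_top
    · refine hmain.trans ?_
      refine Filter.liminf_le_of_le (by isBoundedDefault) ?_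
      intro b hb
      obtain ⟨n, hn⟩ := hb.exists
      refine hn.trans ?_
      rw [ENNReal.tsum_sigma']
      calc _ = ∑' p : ℕ, ENNReal.ofReal (g (p + (n + 1))) := by
            congr 1; ext p
            simp only [hball]
            rw [tsum_fintype, Finset.sum_const, Finset.card_univ, Fintype.card_fin, nsmul_eq_mul,
              ENNReal.ofReal_rpow_of_nonneg (by positivity) hd0.le]
            simp only [g]
            rw [ENNReal.ofReal_mul (by positivity)]
            congr 1
            rw [← ENNReal.ofReal_natCast]
            congr 1
            push_cast; ring
        _ ≤ _ := ENNReal.tsum_comp_le_tsum_of_injective (add_left_injective (n + 1))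
              (fun p => ENNReal.ofReal (g p))
  · refine Filter.Eventually.of_forall fun n i => ?_
    rw [hball]
    apply ENNReal.ofReal_le_ofReal
    have : ((i.1 + (n + 1) : ℕ) : ℝ) ^ (-(1 + μ)) ≤ ((n : ℝ) + 1) ^ (-(1 + μ)) := by
      apply Real.rpow_le_rpow_of_nonpos (by positivity) _ (by linarith)
      push_cast
      have : (0 : ℝ) ≤ i.1 := Nat.cast_nonneg _
      linarith
    linarith
  · refine Filter.Eventually.of_forall fun n => ?_
    rintro x ⟨⟨hx0, hx1⟩, hx⟩
    have hx : Set.Infinite _ := hx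
    obtain ⟨q, hq, hnq⟩ := hx.exists_gt n
    have hq : |q * x - round (q * x)| < (q : ℝ) ^ (-μ) := hq
    obtain ⟨p, rfl⟩ : ∃ p, q = p + (n + 1) := ⟨q - (n + 1), by omega⟩
    set q := p + (n + 1) with hqdef
    have hq1 : 1 ≤ q := by omega
    have hq0 : (0 : ℝ) < q := by exact_mod_cast hq1
    have hr0 : 0 ≤ round (q * x) := by
      rw [round_eq]; apply Int.floor_nonneg.mpr; positivity
    have hr1 : round (q * x) ≤ q := by
      rw [round_eq]
      apply Int.lt_add_one_iff.mp
      rw [Int.floor_lt]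
      push_cast
      nlinarith
    obtain ⟨m, hm⟩ := Int.eq_ofNat_of_zero_le hr0
    have hmq : m < q + 1 := by omega
    refine Set.mem_iUnion.mpr ⟨⟨p, ⟨m, hmq⟩⟩, ?_⟩
    simp only [← hqdef]
    rw [mem_closedBall, Real.dist_eq]
    rw [hm, Int.cast_natCast] at hq
    have e : x - m / q = (q * x - m) / q := by field_simp
    rw [e, abs_div, Nat.abs_cast, div_le_iff₀ hq0]
    have h1 : (q : ℝ) ^ (-(1 + μ)) * (q : ℝ) = (q : ℝ) ^ (-μ) := by
      nth_rewrite 2 [← Real.rpow_one (q : ℝ)]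
      rw [← Real.rpow_add hq0]; congr 1; ring
    rw [h1]; exact hq.le

theorem jarnik_besicovitch (μ : ℝ) (hμ : 1 < μ) :
    dimH {ω : AddCircle (1:ℝ) |
        {p : ℕ | ‖p • ω‖ < (p : ℝ) ^ (-μ)}.Infinite}
      = ENNReal.ofReal (2 / (1 + μ)) := by
  exact le_antisymm (jb_upper μ hμ) (jb_lower μ hμ)
end
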